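/- arXiv:1507.04373 — 3 statements merged into one kernel-verified Lean document; each statement's English description precedes it below -/
import Mathlib

section
/- Every finite nonsolvable group G that is not simple satisfies ω(G) ≥ 6. -/
open scoped MatrixGroups

/-- The number of orbits of the natural action of the automorphism group `Aut G`
on the group `G`. -/
noncomputable def omegaAut (G : Type*) [Group G] : ℕ :=
  Nat.card (MulAction.orbitRel.Quotient (MulAut G) G)

/-! ### Burnside's theorem on prime divisors -/

theorem sum_eq_zero_or_eq_of_isIntegral_div_card {ι : Type*} [Fintype ι] [Nonempty ι] {n : ℕ}
    (hn : n ≠ 0) (z : ι → ℂ) (hz : ∀ i, z i ^ n = 1)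
    (h : IsIntegral ℤ ((∑ i, z i) / Fintype.card ι)) :
    ∑ i, z i = 0 ∨ ∀ i, z i = (∑ i, z i) / Fintype.card ι := by
  by_cases h0 : ∑ i, z i = 0
  · exact Or.inl h0
  right
  have hc : (Fintype.card ι : ℂ) ≠ 0 := by simp
  set K := IntermediateField.adjoin ℚ (Set.range z) with hK
  have hzi : ∀ i, IsIntegral ℚ (z i) := fun i ↦
    IsIntegral.of_pow (Nat.pos_of_ne_zero hn) (by rw [hz i]; exact isIntegral_one)
  have hfd : FiniteDimensional ℚ K :=
    IntermediateField.finiteDimensional_adjoin (by rintro _ ⟨i, rfl⟩; exact hzi i)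
  have : NumberField K := ⟨⟩
  let w : ι → K := fun i ↦ ⟨z i, IntermediateField.subset_adjoin ℚ _ ⟨i, rfl⟩⟩
  have hw : ∀ i, w i ^ n = 1 := fun i ↦ Subtype.ext (hz i)
  let a : K := (∑ i, w i) / Fintype.card ι
  have ha : (a : ℂ) = (∑ i, z i) / Fintype.card ι := by simp [a, w]
  have ha0 : a ≠ 0 := by
    intro h'
    rw [h'] at ha
    exact div_ne_zero h0 hc (by simpa using ha.symm)
  have hai : IsIntegral ℤ a := by
    rw [← ha] at h
    exact (isIntegral_algHom_iff (K.val.restrictScalars ℤ) K.val.injective).1 h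
  obtain ⟨k, hk, hak⟩ := NumberField.Embeddings.pow_eq_one_of_norm_le_one K ℂ ha0 hai (by
    intro φ
    have hφ : ∀ i, ‖φ (w i)‖ = 1 := fun i ↦
      Complex.norm_eq_one_of_pow_eq_one (by rw [← map_pow, hw, map_one]) hn
    simp only [a, map_div₀, map_sum, map_natCast, norm_div, Complex.norm_natCast]
    rw [div_le_one (by positivity)]
    refine (norm_sum_le _ _).trans ?_
    simp [hφ])
  have hna : ‖(a : ℂ)‖ = 1 := by
    refine Complex.norm_eq_one_of_pow_eq_one (n := k) ?_ hk.ne'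
    exact_mod_cast congrArg (Subtype.val) hak
  rw [← ha]
  have hac : (a : ℂ) ≠ 0 := by intro h; simp [h] at hna
  have hnorm : ∀ i, ‖z i / a‖ = 1 := fun i ↦ by
    rw [norm_div, hna, Complex.norm_eq_one_of_pow_eq_one (hz i) hn, div_one]
  have hsum : ∑ i, (z i / a) = Fintype.card ι := by
    rw [← Finset.sum_div, div_eq_iff hac, ha]
    field_simp
  have hre : ∑ i, (z i / a).re = ∑ i : ι, (1 : ℝ) := by
    rw [← Complex.re_sum, hsum]; simp
  have hle : ∀ i ∈ Finset.univ, (z i / a).re ≤ 1 := fun i _ ↦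
    (Complex.re_le_norm _).trans (hnorm i).le
  have heq := (Finset.sum_eq_sum_iff_of_le hle).1 hre
  intro i
  have h1 := heq i (Finset.mem_univ i)
  have h2 : (z i / a).im = 0 := by
    have := hnorm i
    rw [← sq_eq_sq₀ (by positivity) (by positivity), Complex.sq_norm, Complex.normSq_apply, h1] at this
    nlinarith
  have : z i / a = 1 := Complex.ext h1 h2
  rwa [div_eq_one_iff_eq hac] at this

theorem matrix_trace_eq_zero_or_scalar {d n : ℕ} [NeZero d] (hn : n ≠ 0)
    (M : Matrix (Fin d) (Fin d) ℂ) (hM : M ^ n = 1) (h : IsIntegral ℤ (M.trace / d)) :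
    M.trace = 0 ∨ ∃ c : ℂ, M = Matrix.scalar (Fin d) c := by
  have hcard : M.charpoly.roots.card = d := by
    rw [← (IsAlgClosed.splits M.charpoly).natDegree_eq_card_roots,
      Matrix.charpoly_natDegree_eq_dim, Fintype.card_fin]
  let s := M.charpoly.roots
  have hcs : Fintype.card s.ToType = d := by rw [Multiset.card_coe, hcard]
  have htr : M.trace = ∑ i : s.ToType, i.1 := by
    rw [Matrix.trace_eq_sum_roots_charpoly M]
    exact (congrArg Multiset.sum (Multiset.map_univ_coe s)).symm
  have hann : Polynomial.aeval M (Polynomial.X ^ n - 1 : Polynomial ℂ) = 0 := by simp [hM]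
  have hroot : ∀ i : s.ToType, i.1 ^ n = 1 := by
    intro i
    have hi : i.1 ∈ M.charpoly.roots := Multiset.coe_mem
    have hr := (Polynomial.mem_roots'.1 hi).2
    have hm : (minpoly ℂ M).IsRoot i.1 := by
      rw [← Matrix.minpoly_toLin', ← Module.End.hasEigenvalue_iff_isRoot,
        Module.End.hasEigenvalue_iff_isRoot_charpoly]
      simpa using hr
    have := hm.dvd (minpoly.dvd ℂ M hann)
    simpa [sub_eq_zero] using this
  have : Nonempty s.ToType := Fintype.card_pos_iff.1 (by rw [hcs]; exact NeZero.pos d)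
  rw [htr, ← hcs] at h
  refine (sum_eq_zero_or_eq_of_isIntegral_div_card hn _ hroot h).imp (fun h ↦ htr.trans h) ?_
  intro hall
  set c := (∑ i : s.ToType, i.1) / Fintype.card s.ToType
  refine ⟨c, ?_⟩
  have hchar : M.charpoly = (Polynomial.X - Polynomial.C c) ^ d := by
    have h1 := (IsAlgClosed.splits M.charpoly).eq_prod_roots_of_monic M.charpoly_monic
    have h2 : s = Multiset.replicate d c := by
      rw [Multiset.eq_replicate]
      refine ⟨hcard, fun b hb ↦ ?_⟩
      rw [← Multiset.map_univ_coe s, Multiset.mem_map] at hb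
      obtain ⟨i, -, rfl⟩ := hb
      exact hall i
    rw [h1]
    change (Multiset.map _ s).prod = _
    rw [h2]
    simp
  have hdvd : minpoly ℂ M ∣ (Polynomial.X - Polynomial.C c) ^ d := by
    rw [← hchar]; exact Matrix.minpoly_dvd_charpoly M
  have hsq : Squarefree (minpoly ℂ M) :=
    ((Polynomial.X_pow_sub_one_separable_iff.2 (by exact_mod_cast hn)).squarefree).squarefree_of_dvd
      (minpoly.dvd ℂ M hann)
  have hirr : Irreducible (Polynomial.X - Polynomial.C c) := Polynomial.irreducible_X_sub_C c
  have hdvd' : minpoly ℂ M ∣ Polynomial.X - Polynomial.C c :=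
    (hsq.dvd_pow_iff_dvd (NeZero.ne d)).1 hdvd
  obtain ⟨q, hq⟩ := hdvd'
  have h0 : Polynomial.aeval M (Polynomial.X - Polynomial.C c) = 0 := by
    rw [hq, map_mul, minpoly.aeval, zero_mul]
  rw [map_sub, Polynomial.aeval_X, Polynomial.aeval_C, sub_eq_zero] at h0
  rw [h0]
  rfl
theorem trace_mulLeft_pi_matrix {ι : Type*} [Fintype ι] {d : ι → ℕ}
    (a : Π i, Matrix (Fin (d i)) (Fin (d i)) ℂ) :
    LinearMap.trace ℂ _ (LinearMap.mulLeft ℂ a) = ∑ i, (d i : ℂ) * (a i).trace := by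
  classical
  rw [LinearMap.trace_eq_matrix_trace ℂ
    (Pi.basis fun i ↦ Matrix.stdBasis ℂ (Fin (d i)) (Fin (d i))), Matrix.trace]
  rw [Fintype.sum_sigma]
  refine Finset.sum_congr rfl fun i _ ↦ ?_
  have key : ∀ k l : Fin (d i), (Matrix.stdBasis ℂ (Fin (d i)) (Fin (d i))).repr
      (a i * Matrix.single k l 1) (k, l) = a i k k := fun k l ↦ by
    have : ∀ M : Matrix (Fin (d i)) (Fin (d i)) ℂ,
      (Matrix.stdBasis ℂ (Fin (d i)) (Fin (d i))).repr M (k, l) = M k l := fun M ↦ by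
        simp [Matrix.stdBasis]
    rw [this]
    simp
  rw [Fintype.sum_prod_type, Matrix.trace, Finset.mul_sum]
  refine Finset.sum_congr rfl fun k _ ↦ ?_
  simp only [Matrix.diag_apply, LinearMap.toMatrix_apply, LinearMap.mulLeft_apply, Pi.basis_repr,
    Pi.mul_apply, Pi.basis_apply, Pi.single_eq_same, Matrix.stdBasis_eq_single, key]
  simp
theorem trace_mulLeft_of {G : Type*} [Group G] [Finite G] {g : G} (hg : g ≠ 1) :
    LinearMap.trace ℂ _ (LinearMap.mulLeft ℂ (MonoidAlgebra.of ℂ G g)) = 0 := by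
  classical
  have := Fintype.ofFinite G
  rw [LinearMap.trace_eq_matrix_trace ℂ (MonoidAlgebra.basis G ℂ), Matrix.trace]
  refine Finset.sum_eq_zero fun h _ ↦ ?_
  simp only [Matrix.diag_apply, LinearMap.toMatrix_apply, LinearMap.mulLeft_apply,
    MonoidAlgebra.basis_apply, MonoidAlgebra.of_apply, MonoidAlgebra.single_mul_single, mul_one]
  change (MonoidAlgebra.single (g * h) (1 : ℂ)).coeff h = 0
  simp [hg]

theorem isIntegral_matrix_trace_of_pow_eq_one {d n : ℕ} (hn : n ≠ 0)
    (M : Matrix (Fin d) (Fin d) ℂ) (hM : M ^ n = 1) : IsIntegral ℤ M.trace := by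
  rw [Matrix.trace_eq_sum_roots_charpoly M]
  refine IsIntegral.multiset_sum fun x hx ↦ ?_
  have hr := (Polynomial.mem_roots'.1 hx).2
  have hm : (minpoly ℂ M).IsRoot x := by
    rw [← Matrix.minpoly_toLin', ← Module.End.hasEigenvalue_iff_isRoot,
      Module.End.hasEigenvalue_iff_isRoot_charpoly]
    simpa using hr
  have hann : Polynomial.aeval M (Polynomial.X ^ n - 1 : Polynomial ℂ) = 0 := by simp [hM]
  have h1 : x ^ n = 1 := by simpa [sub_eq_zero] using hm.dvd (minpoly.dvd ℂ M hann)
  exact IsIntegral.of_pow (Nat.pos_of_ne_zero hn) (by rw [h1]; exact isIntegral_one)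

theorem isIntegral_sum_of {G : Type*} [Group G] [Finite G] (C : Finset G) :
    IsIntegral ℤ (∑ x ∈ C, MonoidAlgebra.of ℂ G x) := by
  have : Module.Finite ℤ (MonoidAlgebra ℤ G) := Module.Finite.of_basis (MonoidAlgebra.basis G ℤ)
  have h := (Algebra.IsIntegral.isIntegral (R := ℤ) (∑ x ∈ C, MonoidAlgebra.of ℤ G x)).map
    (MonoidAlgebra.lift ℤ (MonoidAlgebra ℂ G) G (MonoidAlgebra.of ℂ G))
  simpa only [map_sum, MonoidAlgebra.lift_of] using h

/-- If the class of `g` has prime power order `p ^ k` and the degree `d` of the irreducible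
representation `φ` is prime to `p`, then either the character vanishes at `g` or `g` acts as a
scalar. -/
theorem trace_eq_zero_or_scalar_of_card_class {G : Type*} [Group G] [Finite G] {p k d : ℕ}
    [NeZero d] (hp : p.Prime) (hd : ¬ p ∣ d) {g : G} (C : Finset G)
    (hC : ∀ x, x ∈ C ↔ IsConj g x) (hk : C.card = p ^ k)
    (φ : MonoidAlgebra ℂ G →ₐ[ℂ] Matrix (Fin d) (Fin d) ℂ) (hφ : Function.Surjective φ) :
    (φ (MonoidAlgebra.of ℂ G g)).trace = 0 ∨
      ∃ c : ℂ, φ (MonoidAlgebra.of ℂ G g) = Matrix.scalar (Fin d) c := by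
  classical
  set ρ : G →* Matrix (Fin d) (Fin d) ℂ := (φ : MonoidAlgebra ℂ G →* _).comp (MonoidAlgebra.of ℂ G)
    with hρ
  have hφρ : ∀ x, φ (MonoidAlgebra.of ℂ G x) = ρ x := fun _ ↦ rfl
  have hd0 : (d : ℂ) ≠ 0 := by exact_mod_cast NeZero.ne d
  have hn : Nat.card G ≠ 0 := Nat.card_pos.ne'
  have hpow : (φ (MonoidAlgebra.of ℂ G g)) ^ Nat.card G = 1 := by
    rw [← map_pow, ← map_pow, pow_card_eq_one', map_one, map_one]
  refine matrix_trace_eq_zero_or_scalar hn _ hpow ?_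
  have htr := isIntegral_matrix_trace_of_pow_eq_one hn _ hpow
  rw [hφρ] at *
  have hclass : ∀ x ∈ C, (ρ x).trace = (ρ g).trace := by
    intro x hx
    obtain ⟨h, rfl⟩ := isConj_iff.1 ((hC x).1 hx)
    rw [map_mul, Matrix.trace_mul_comm, ← map_mul]
    simp
  set s := φ (∑ x ∈ C, MonoidAlgebra.of ℂ G x) with hs
  have hsρ : s = ∑ x ∈ C, ρ x := by rw [hs, map_sum]; rfl
  have hcomm : ∀ h : G, Commute (MonoidAlgebra.of ℂ G h) (∑ x ∈ C, MonoidAlgebra.of ℂ G x) := by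
    intro h
    rw [Commute, SemiconjBy, Finset.mul_sum, Finset.sum_mul]
    refine Finset.sum_bij (fun x _ ↦ h * x * h⁻¹) (fun x hx ↦ ?_) (fun x _ y _ hxy ↦ by simpa using hxy)
      (fun y hy ↦ ⟨h⁻¹ * y * h, ?_, by group⟩) (fun x _ ↦ ?_)
    · rw [hC] at hx ⊢
      exact hx.trans (isConj_iff.2 ⟨h, rfl⟩)
    · rw [hC] at hy ⊢
      exact hy.trans (isConj_iff.2 ⟨h⁻¹, by group⟩)
    · rw [← map_mul, ← map_mul]; congr 1; group
  have hcomm' : ∀ a, Commute a (∑ x ∈ C, MonoidAlgebra.of ℂ G x) := by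
    intro a
    induction a using MonoidAlgebra.induction_on with
    | of h => exact hcomm h
    | add a b ha hb => exact ha.add_left hb
    | smul r a ha => exact ha.smul_left r
  obtain ⟨w, hw⟩ : s ∈ Set.range (Matrix.scalar (Fin d)) := by
    refine Matrix.mem_range_scalar_of_commute_single fun i j _ ↦ ?_
    obtain ⟨a, ha⟩ := hφ (Matrix.single i j 1)
    rw [← ha]
    exact (hcomm' a).map φ
  have hwi : IsIntegral ℤ w := by
    have h1 : IsIntegral ℤ s := (isIntegral_sum_of C).map (φ.restrictScalars ℤ)
    rw [← hw] at h1
    change IsIntegral ℤ (algebraMap ℂ (Matrix (Fin d) (Fin d) ℂ) w) at h1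
    exact (isIntegral_algHom_iff ((Algebra.ofId ℂ (Matrix (Fin d) (Fin d) ℂ)).restrictScalars ℤ)
      (algebraMap ℂ (Matrix (Fin d) (Fin d) ℂ)).injective).1 h1
  have hwt : (d : ℂ) * w = (p ^ k : ℕ) * (ρ g).trace := by
    have h1 : s.trace = (p ^ k : ℕ) * (ρ g).trace := by
      rw [hsρ, Matrix.trace_sum, Finset.sum_congr rfl hclass, Finset.sum_const, hk, nsmul_eq_mul]
    rw [← h1, ← hw]
    simp [Matrix.trace, mul_comm]
  have hcop : IsCoprime (d : ℤ) ((p ^ k : ℕ) : ℤ) :=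
    Nat.isCoprime_iff_coprime.2 (((Nat.Prime.coprime_iff_not_dvd hp).2 hd).symm.pow_right k)
  obtain ⟨u, v, huv⟩ := hcop
  have : (ρ g).trace / d = u * (ρ g).trace + v * w := by
    have huv' : (u : ℂ) * d + v * (p ^ k : ℕ) = 1 := by exact_mod_cast huv
    rw [div_eq_iff hd0]
    linear_combination (-(ρ g).trace) * huv' - v * hwt
  rw [this]
  exact ((isIntegral_algebraMap (R := ℤ) (x := u)).mul htr).add
    ((isIntegral_algebraMap (R := ℤ) (x := v)).mul hwi)

/-- In a finite simple group, an element whose conjugacy class has prime power order is central. -/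
theorem mem_center_of_card_class_eq_prime_pow {G : Type*} [Group G] [Finite G] [IsSimpleGroup G]
    {p k : ℕ} (hp : p.Prime) {g : G} (hg : g ≠ 1) (C : Finset G)
    (hC : ∀ x, x ∈ C ↔ IsConj g x) (hk : C.card = p ^ k) : g ∈ Subgroup.center G := by
  classical
  have := Fintype.ofFinite G
  by_contra hcen
  have : Module.Finite ℂ (MonoidAlgebra ℂ G) := Module.Finite.of_basis (MonoidAlgebra.basis G ℂ)
  obtain ⟨n, d, hd, ⟨Φ⟩⟩ :=
    IsSemisimpleRing.exists_algEquiv_pi_matrix_of_isAlgClosed ℂ (MonoidAlgebra ℂ G)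
  let φ : ∀ i, MonoidAlgebra ℂ G →ₐ[ℂ] Matrix (Fin (d i)) (Fin (d i)) ℂ :=
    fun i ↦ (Pi.evalAlgHom ℂ _ i).comp Φ.toAlgHom
  have hφΦ : ∀ i a, φ i a = Φ a i := fun _ _ ↦ rfl
  have hφ : ∀ i, Function.Surjective (φ i) := fun i M ↦
    ⟨Φ.symm (Pi.single i M), by rw [hφΦ, AlgEquiv.apply_symm_apply, Pi.single_eq_same]⟩
  let o := MonoidAlgebra.of ℂ G
  have hone : ∀ i, (1 : Matrix (Fin (d i)) (Fin (d i)) ℂ) ≠ 0 := fun i ↦ one_ne_zero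
  have hsum : ∑ i, (d i : ℂ) * (φ i (o g)).trace = 0 := by
    rw [← trace_mulLeft_of hg, ← LinearMap.trace_conj' _ Φ.toLinearEquiv]
    refine (trace_mulLeft_pi_matrix (Φ (o g))).symm.trans ?_
    congr 1
    refine LinearMap.ext fun a ↦ ?_
    simp [LinearEquiv.conj_apply, o]
  -- the trivial representation occurs exactly once, with degree one
  obtain ⟨i₀, hi₀⟩ : ∃ i, ∀ x, φ i (o x) = 1 := by
    set e := ∑ x : G, o x with he
    have hmul : ∀ x, o x * e = e := fun x ↦ by
      rw [he, Finset.mul_sum]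
      exact Fintype.sum_equiv (Equiv.mulLeft x) _ _ fun y ↦ (map_mul o x y).symm
    have hmul' : ∀ x, e * o x = e := fun x ↦ by
      rw [he, Finset.sum_mul]
      exact Fintype.sum_equiv (Equiv.mulRight x) _ _ fun y ↦ (map_mul o y x).symm
    have he0 : e ≠ 0 := by
      intro h0
      have h1 := congrArg (fun a : MonoidAlgebra ℂ G ↦ MonoidAlgebra.lift ℂ ℂ G 1 a) h0
      simp only [he, map_sum, map_zero] at h1
      simp [o] at h1
    obtain ⟨i, hi⟩ : ∃ i, φ i e ≠ 0 := by
      by_contra! h0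
      exact he0 (Φ.injective (by rw [map_zero]; exact funext h0))
    have hcomm : ∀ a, Commute a e := by
      intro a
      induction a using MonoidAlgebra.induction_on with
      | of h => exact (hmul h).trans (hmul' h).symm
      | add a b ha hb => exact ha.add_left hb
      | smul r a ha => exact ha.smul_left r
    obtain ⟨c, hc⟩ : φ i e ∈ Set.range (Matrix.scalar (Fin (d i))) := by
      refine Matrix.mem_range_scalar_of_commute_single fun k l _ ↦ ?_
      obtain ⟨a, ha⟩ := hφ i (Matrix.single k l 1)
      rw [← ha]
      exact (hcomm a).map (φ i)
    have hc0 : c ≠ 0 := by rintro rfl; exact hi (by rw [← hc, map_zero])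
    refine ⟨i, fun x ↦ ?_⟩
    have h1 : φ i (o x) * φ i e = φ i e := by rw [← map_mul, hmul]
    rw [← hc] at h1
    have h2 : c • φ i (o x) = c • 1 := by
      have h3 : Matrix.scalar (Fin (d i)) c = c • 1 := (Matrix.smul_one_eq_diagonal c).symm
      rwa [h3, mul_smul_comm, mul_one] at h1
    exact smul_right_injective _ hc0 h2
  have htriv : ∀ i, (∀ x, φ i (o x) = 1) →
      ∀ a, φ i a = algebraMap ℂ _ (MonoidAlgebra.lift ℂ ℂ G 1 a) := by
    intro i hi a
    induction a using MonoidAlgebra.induction_on with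
    | of h => exact (hi h).trans (by simp)
    | add a b ha hb => rw [map_add, ha, hb, map_add, map_add]
    | smul r a ha => rw [map_smul, ha, map_smul, smul_eq_mul, map_mul, Algebra.smul_def]
  have huniq : ∀ i, (∀ x, φ i (o x) = 1) → i = i₀ := by
    intro i hi
    by_contra hne
    set a := Φ.symm (Pi.single i₀ 1)
    have h1 : φ i a = 0 := by rw [hφΦ, AlgEquiv.apply_symm_apply, Pi.single_eq_of_ne hne]
    have h2 : φ i₀ a = 1 := by rw [hφΦ, AlgEquiv.apply_symm_apply, Pi.single_eq_same]
    rw [htriv i hi, FaithfulSMul.algebraMap_eq_zero_iff] at h1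
    rw [htriv i₀ hi₀, h1, map_zero] at h2
    exact hone i₀ h2.symm
  have hd₀ : d i₀ = 1 := by
    by_contra hne
    have h2 : 1 < d i₀ := by have := NeZero.ne (d i₀); omega
    obtain ⟨a, ha⟩ := hφ i₀ (Matrix.single ⟨0, by omega⟩ ⟨1, h2⟩ 1)
    have h3 := congrFun (congrFun ((htriv i₀ hi₀ a).symm.trans ha) ⟨0, by omega⟩) ⟨1, h2⟩
    simp [Matrix.algebraMap_matrix_apply] at h3
  have hother : ∀ i, i ≠ i₀ → ∃ w : ℂ, IsIntegral ℤ w ∧ (d i : ℂ) * (φ i (o g)).trace = p * w := by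
    intro i hi
    by_cases hpd : p ∣ d i
    · obtain ⟨m, hm⟩ := hpd
      refine ⟨m * (φ i (o g)).trace, ?_, ?_⟩
      swap
      · rw [← mul_assoc, ← Nat.cast_mul, ← hm]
      refine (isIntegral_algebraMap (R := ℤ) (x := (m : ℤ))).mul ?_
      refine isIntegral_matrix_trace_of_pow_eq_one (n := Nat.card G) Nat.card_pos.ne' _ ?_
      rw [← map_pow, ← map_pow, pow_card_eq_one', map_one, map_one]
    · refine ⟨0, isIntegral_zero, ?_⟩
      rcases trace_eq_zero_or_scalar_of_card_class hp hpd C hC hk (φ i) (hφ i) with h | ⟨c, hc⟩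
      · simp only [o, h, mul_zero]
      exfalso
      let ρ : G →* Matrix (Fin (d i)) (Fin (d i)) ℂ := ((φ i : _ →* _)).comp o
      rcases Subgroup.Normal.eq_bot_or_eq_top (H := ρ.ker) inferInstance with h | h
      · refine hcen (Subgroup.mem_center_iff.2 fun x ↦ (MonoidHom.ker_eq_bot_iff ρ).1 h ?_)
        rw [map_mul, map_mul]
        change _ * φ i (o g) = φ i (o g) * _
        rw [hc]
        exact (Matrix.scalar_commute c (Commute.all c) _).symm
      · exact hi (huniq i fun x ↦ (MonoidHom.mem_ker (f := ρ)).1 (h ▸ Subgroup.mem_top x))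
  choose! w hw hw' using hother
  have hone' : (d i₀ : ℂ) * (φ i₀ (o g)).trace = 1 := by
    rw [hi₀, Matrix.trace_one, Fintype.card_fin]
    simp [hd₀]
  rw [← Finset.add_sum_erase _ _ (Finset.mem_univ i₀), hone',
    Finset.sum_congr rfl (fun i hi ↦ hw' i (Finset.ne_of_mem_erase hi)), ← Finset.mul_sum] at hsum
  set W := ∑ i ∈ Finset.univ.erase i₀, w i
  have hW : IsIntegral ℤ W := IsIntegral.sum _ fun i hi ↦ hw i (Finset.ne_of_mem_erase hi)
  have hp0 : (p : ℂ) ≠ 0 := by exact_mod_cast hp.ne_zero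
  have hWq : W = algebraMap ℚ ℂ (-1 / p) := by
    rw [map_div₀, map_neg, map_one, map_natCast, eq_div_iff hp0]
    linear_combination hsum
  rw [hWq, isIntegral_algebraMap_iff (algebraMap ℚ ℂ).injective] at hW
  obtain ⟨m, hm⟩ := IsIntegrallyClosed.isIntegral_iff.1 hW
  have hpq : (p : ℚ) ≠ 0 := by exact_mod_cast hp.ne_zero
  rw [eq_div_iff hpq, algebraMap_int_eq, eq_intCast] at hm
  have hm' : m * (p : ℤ) = -1 := by exact_mod_cast hm
  have : (p : ℤ) ∣ 1 := ⟨-m, by linarith⟩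
  exact hp.one_lt.ne' (by exact_mod_cast Int.eq_one_of_dvd_one (by positivity) this)

theorem mem_center_of_index_centralizer_eq_prime_pow {G : Type*} [Group G] [Finite G]
    [IsSimpleGroup G] {p k : ℕ} (hp : p.Prime) {g : G} (hg : g ≠ 1)
    (h : (Subgroup.centralizer {g}).index = p ^ k) : g ∈ Subgroup.center G := by
  classical
  have := Fintype.ofFinite G
  refine mem_center_of_card_class_eq_prime_pow hp hg (ConjClasses.mk g).carrier.toFinset
    (fun x ↦ ?_) (k := k) ?_
  · rw [Set.mem_toFinset, ConjClasses.mem_carrier_iff_mk_eq, ConjClasses.mk_eq_mk_iff_isConj,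
      isConj_comm]
  · rw [Set.toFinset_card, ConjClasses.card_carrier, ← h, ← Nat.card_eq_fintype_card,
      ← Nat.card_eq_fintype_card, ← Subgroup.nat_card_centralizer_nat_card_stabilizer]
    exact Nat.div_eq_of_eq_mul_left Nat.card_pos (Subgroup.index_mul_card _).symm

/-- A nonabelian finite simple group has at least three prime divisors. -/
theorem three_le_card_primeFactors_of_isSimpleGroup {G : Type*} [Group G] [Finite G]
    [IsSimpleGroup G] (h : ¬ Group.IsSolvable G) : 3 ≤ (Nat.card G).primeFactors.card := by
  by_contra! hlt
  have hcen : Subgroup.center G = ⊥ := by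
    refine (Subgroup.Normal.eq_bot_or_eq_top (H := Subgroup.center G) inferInstance).resolve_right
      fun htop ↦ h (Group.isSolvable_of_comm fun a b ↦ ?_)
    exact (Subgroup.mem_center_iff.1 (htop ▸ Subgroup.mem_top b) a)
  have hn1 : Nat.card G ≠ 1 := (Finite.one_lt_card (α := G)).ne'
  obtain ⟨p, hp⟩ := Nat.nonempty_primeFactors.2 (Finite.one_lt_card (α := G))
  have hpp := Nat.prime_of_mem_primeFactors hp
  have : Fact p.Prime := ⟨hpp⟩
  obtain ⟨q, hq, hpq⟩ : ∃ q : ℕ, q.Prime ∧ (Nat.card G).primeFactors ⊆ {p, q} := by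
    have h1 : ((Nat.card G).primeFactors.erase p).card ≤ 1 := by
      rw [Finset.card_erase_of_mem hp]; omega
    rcases Finset.eq_empty_or_nonempty ((Nat.card G).primeFactors.erase p) with h2 | ⟨q, hq⟩
    · exact ⟨p, hpp, fun r hr ↦ by
        by_contra hne
        have : r ∈ (Nat.card G).primeFactors.erase p :=
          Finset.mem_erase.2 ⟨fun h ↦ hne (by simp [h]), hr⟩
        simp [h2] at this⟩
    · refine ⟨q, Nat.prime_of_mem_primeFactors (Finset.mem_of_mem_erase hq), fun r hr ↦ ?_⟩
      by_cases hrp : r = p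
      · simp [hrp]
      · simp [Finset.card_le_one.1 h1 r (Finset.mem_erase.2 ⟨hrp, hr⟩) q hq]
  let P : Sylow p G := default
  have hPn : Nontrivial P := by
    have hc := P.dvd_card_of_dvd_card (Nat.dvd_of_mem_primeFactors hp)
    exact Finite.one_lt_card_iff_nontrivial.1
      (hpp.one_lt.trans_le (Nat.le_of_dvd Nat.card_pos hc))
  have := P.isPGroup'.center_nontrivial
  obtain ⟨z, hz⟩ := exists_ne (1 : Subgroup.center P)
  have hz1 : (z : G) ≠ 1 := fun h1 ↦ hz (Subtype.ext (Subtype.ext h1))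
  have hle : (P : Subgroup G) ≤ Subgroup.centralizer {((z : P) : G)} := fun x hx ↦ by
    rw [Subgroup.mem_centralizer_singleton_iff]
    exact congrArg Subtype.val (Subgroup.mem_center_iff.1 z.2 ⟨x, hx⟩)
  have hdvd := Subgroup.index_dvd_of_le hle
  have hnp : ¬ p ∣ (Subgroup.centralizer {((z : P) : G)}).index := fun h1 ↦
    P.not_dvd_index (h1.trans hdvd)
  have hpow : ∃ k, (Subgroup.centralizer {((z : P) : G)}).index = q ^ k := by
    refine ⟨_, Nat.eq_prime_pow_of_unique_prime_dvd Subgroup.FiniteIndex.index_ne_zero ?_⟩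
    intro r hr hrd
    have hr' : r ∈ (Nat.card G).primeFactors :=
      Nat.mem_primeFactors.2 ⟨hr, hrd.trans (Subgroup.index_dvd_card _), Nat.card_pos.ne'⟩
    rcases Finset.mem_insert.1 (hpq hr') with rfl | h2
    · exact absurd hrd hnp
    · exact Finset.mem_singleton.1 h2
  obtain ⟨k, hk⟩ := hpow
  have := mem_center_of_index_centralizer_eq_prime_pow hq hz1 hk
  rw [hcen] at this
  exact hz1 (Subgroup.mem_bot.1 this)

/-- **Burnside's theorem**: a finite nonsolvable group has at least three prime divisors. -/
theorem three_le_card_primeFactors {G : Type*} [Group G] [Finite G]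
    (h : ¬ Group.IsSolvable G) : 3 ≤ (Nat.card G).primeFactors.card := by
  induction hn : Nat.card G using Nat.strong_induction_on generalizing G with
  | _ n ih =>
  by_cases hs : IsSimpleGroup G
  · exact hn ▸ three_le_card_primeFactors_of_isSimpleGroup h
  have : Nontrivial G := by
    by_contra hG
    rw [not_nontrivial_iff_subsingleton] at hG
    exact h inferInstance
  obtain ⟨N, hN, hbot, htop⟩ : ∃ N : Subgroup G, N.Normal ∧ N ≠ ⊥ ∧ N ≠ ⊤ := by
    by_contra! hall
    exact hs ⟨fun N hN ↦ or_iff_not_imp_left.2 (hall N hN)⟩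
  have hmul := N.card_eq_card_quotient_mul_card_subgroup
  have hN1 : 1 < Nat.card N := (Subgroup.one_lt_card_iff_ne_bot N).2 hbot
  have hNtop : Nat.card N < Nat.card G := by
    refine lt_of_le_of_ne (Subgroup.card_le_card_group N) fun h1 ↦ htop ?_
    exact Subgroup.card_eq_iff_eq_top N |>.1 h1
  rw [Group.isSolvable_iff_subgroup_quotient N, not_and_or] at h
  rcases h with h | h
  · refine (ih _ (hn ▸ hNtop) h rfl).trans (Finset.card_le_card ?_)
    exact hn ▸ Nat.primeFactors_mono (Subgroup.card_subgroup_dvd_card N) Nat.card_pos.ne'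
  · refine (ih _ (hn ▸ ?_) h rfl).trans (Finset.card_le_card ?_)
    · exact hn ▸ Nat.primeFactors_mono (Subgroup.card_quotient_dvd_card N) Nat.card_pos.ne'
    · rw [hmul]
      exact lt_mul_of_one_lt_right Nat.card_pos hN1

/-! ### Automorphism orbits -/

/-- An invariant `c` taking all the values in `s` bounds the number of automorphism orbits below;
in case of equality it takes no other values and separates the orbits. -/
theorem card_le_omegaAut {G : Type*} [Group G] [Finite G] (c : G → ℕ)
    (hc : ∀ (α : MulAut G) x, c (α x) = c x) (s : Finset ℕ) (hs : ∀ n ∈ s, ∃ x, c x = n) :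
    s.card ≤ omegaAut G ∧ (omegaAut G ≤ s.card →
      (∀ x, c x ∈ s) ∧ ∀ x y, c x = c y → ∃ α : MulAut G, α x = y) := by
  classical
  have : Fintype (MulAction.orbitRel.Quotient (MulAut G) G) := Fintype.ofFinite _
  let c' : MulAction.orbitRel.Quotient (MulAut G) G → ℕ := Quotient.lift c fun a b hab ↦ by
    obtain ⟨α, rfl⟩ := hab
    exact hc α b
  have hsub : s ⊆ Finset.univ.image c' := fun n hn ↦ by
    obtain ⟨x, rfl⟩ := hs n hn
    exact Finset.mem_image.2 ⟨Quotient.mk'' x, Finset.mem_univ _, rfl⟩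
  have hcard : omegaAut G = (Finset.univ : Finset
      (MulAction.orbitRel.Quotient (MulAut G) G)).card := by
    rw [omegaAut, Nat.card_eq_fintype_card, Finset.card_univ]
  have h1 := Finset.card_le_card hsub
  have h2 : (Finset.univ.image c').card ≤ _ := Finset.card_image_le
  refine ⟨by omega, fun h ↦ ⟨fun x ↦ ?_, fun x y hxy ↦ ?_⟩⟩
  · rw [Finset.eq_of_subset_of_card_le hsub (by omega)]
    exact Finset.mem_image.2 ⟨Quotient.mk'' x, Finset.mem_univ _, rfl⟩
  · have hinj := Finset.card_image_iff.1 (h2.antisymm (by omega))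
    have := hinj (Finset.mem_coe.2 (Finset.mem_univ (Quotient.mk'' y)))
      (Finset.mem_coe.2 (Finset.mem_univ (Quotient.mk'' x))) hxy.symm
    exact Quotient.exact this

theorem Subgroup.Characteristic.apply_mem_iff {G : Type*} [Group G] {N : Subgroup G}
    (hN : N.Characteristic) (α : MulAut G) {x : G} : α x ∈ N ↔ x ∈ N :=
   SetLike.ext_iff.1 (hN.fixed α) x

/-! ### Solvable normal subgroups -/

theorem MulEquiv.isSolvable {A B : Type*} [Group A] [Group B] (e : A ≃* B)
    (h : Group.IsSolvable A) : Group.IsSolvable B :=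
  Group.isSolvable_of_surjective (f := e.toMonoidHom) e.surjective

theorem Subgroup.isSolvable_sup {G : Type*} [Group G] {N R : Subgroup G} [R.Normal]
    (hN : Group.IsSolvable N) (hR : Group.IsSolvable R) :
    Group.IsSolvable (N ⊔ R : Subgroup G) := by
  rw [Group.isSolvable_iff_subgroup_quotient (R.subgroupOf (N ⊔ R))]
  refine ⟨?_, ?_⟩
  · exact (Subgroup.subgroupOfEquivOfLe (le_sup_right : R ≤ N ⊔ R)).symm.isSolvable hR
  · exact (QuotientGroup.quotientInfEquivProdNormalQuotient N R).isSolvable inferInstance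

theorem exists_characteristic_isSolvable {G : Type*} [Group G] [Finite G] :
    ∃ R : Subgroup G, R.Characteristic ∧ Group.IsSolvable R ∧
      ∀ N : Subgroup G, N.Normal → Group.IsSolvable N → N ≤ R := by
  obtain ⟨R, ⟨hRn, hRs⟩, hmax⟩ := (Set.toFinite
    {R : Subgroup G | R.Normal ∧ Group.IsSolvable R}).exists_maximal
      ⟨⊥, inferInstance, inferInstance⟩
  have hle : ∀ N : Subgroup G, N.Normal → Group.IsSolvable N → N ≤ R := fun N hN hs ↦
    le_sup_left.trans (hmax ⟨inferInstance, Subgroup.isSolvable_sup hs hRs⟩ le_sup_right)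
  refine ⟨R, Subgroup.characteristic_iff_map_le.2 fun α ↦ hle _ ?_ ?_, hRs, hle⟩
  · exact hRn.map _ α.surjective
  · exact (R.equivMapOfInjective α.toMonoidHom α.injective).isSolvable hRs

/-- A nonsolvable finite group which is characteristically simple but not simple contains elements
of orders `p`, `q`, `r`, `pq` and `pr` for distinct primes `p`, `q`, `r`. -/
theorem exists_orderOf_mul_of_characteristic {G : Type*} [Group G] [Finite G]
    (h : ¬ Group.IsSolvable G) (hns : ¬ IsSimpleGroup G)
    (hchar : ∀ N : Subgroup G, N.Characteristic → N = ⊥ ∨ N = ⊤) :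
    ∃ p q r : ℕ, p.Prime ∧ q.Prime ∧ r.Prime ∧ p ≠ q ∧ p ≠ r ∧ q ≠ r ∧
      ∀ n ∈ ({p, q, r, p * q, p * r} : Set ℕ), ∃ x : G, orderOf x = n := by
  classical
  obtain ⟨R, hR, hRs, hmax⟩ := exists_characteristic_isSolvable (G := G)
  have hRb : R = ⊥ := (hchar R hR).resolve_right fun ht ↦ h <| by
    subst ht
    exact Subgroup.topEquiv.isSolvable hRs
  have : Nontrivial G := by
    by_contra hG
    rw [not_nontrivial_iff_subsingleton] at hG
    exact h inferInstance
  obtain ⟨N, hN, hbot, htop⟩ : ∃ N : Subgroup G, N.Normal ∧ N ≠ ⊥ ∧ N ≠ ⊤ := by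
    by_contra! hall
    exact hns ⟨fun N hN ↦ or_iff_not_imp_left.2 (hall N hN)⟩
  obtain ⟨M, hMN, ⟨hM, hMbot⟩, hmin⟩ := (Set.toFinite
    {M : Subgroup G | M.Normal ∧ M ≠ ⊥}).exists_le_minimal ⟨hN, hbot⟩
  have hMtop : M ≠ ⊤ := fun ht ↦ htop (top_le_iff.1 (ht ▸ hMN))
  have hMs : ¬ Group.IsSolvable M := fun hs ↦ hMbot (le_bot_iff.1 (hRb ▸ hmax M hM hs))
  obtain ⟨α, hα⟩ : ∃ α : G ≃* G, ¬ M.map α.toMonoidHom ≤ M := by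
    by_contra! hall
    exact (hchar M (Subgroup.characteristic_iff_map_le.2 hall)).elim hMbot hMtop
  have hαn : (M.map α.toMonoidHom).Normal := hM.map _ α.surjective
  have hinf : Disjoint (M.map α.toMonoidHom) M := by
    rw [disjoint_iff]
    by_contra hne
    have h1 : M ≤ M.map α.toMonoidHom ⊓ M := hmin ⟨inferInstance, hne⟩ inf_le_right
    have h2 : M = M.map α.toMonoidHom := Subgroup.eq_of_le_of_card_ge (h1.trans inf_le_left)
      (Nat.card_congr (M.equivMapOfInjective α.toMonoidHom α.injective).toEquiv).ge
    exact hα h2.ge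
  have hcomm := fun a b ha hb ↦ Subgroup.commute_of_normal_of_disjoint _ _ hαn hM hinf a b ha hb
  obtain ⟨p, hp, q, hq, r, hr, hpq, hpr, hqr⟩ := Finset.two_lt_card.1
    (three_le_card_primeFactors hMs)
  have key : ∀ l ∈ (Nat.card M).primeFactors, ∃ x ∈ M, orderOf x = l := fun l hl ↦ by
    have : Fact l.Prime := ⟨Nat.prime_of_mem_primeFactors hl⟩
    obtain ⟨x, hx⟩ := exists_prime_orderOf_dvd_card' l (Nat.dvd_of_mem_primeFactors hl)
    exact ⟨x, x.2, by rw [Subgroup.orderOf_coe, hx]⟩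
  have key' : ∀ l ∈ (Nat.card M).primeFactors, l ≠ p → ∃ x : G, orderOf x = p * l :=
    fun l hl hlp ↦ by
      obtain ⟨x, hx, hxp⟩ := key p hp
      obtain ⟨y, hy, hyl⟩ := key l hl
      have hc := hcomm (α x) y (Subgroup.mem_map_of_mem _ hx) hy
      have hαx : orderOf (α x) = p := by rw [MulEquiv.orderOf_eq, hxp]
      refine ⟨α x * y, ?_⟩
      rw [hc.orderOf_mul_eq_mul_orderOf_of_coprime, hαx, hyl]
      rw [hαx, hyl]
      exact (Nat.coprime_primes (Nat.prime_of_mem_primeFactors hp)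
        (Nat.prime_of_mem_primeFactors hl)).2 hlp.symm
  refine ⟨p, q, r, Nat.prime_of_mem_primeFactors hp, Nat.prime_of_mem_primeFactors hq,
    Nat.prime_of_mem_primeFactors hr, hpq, hpr, hqr, ?_⟩
  have weak : ∀ l, (∃ x ∈ M, orderOf x = l) → ∃ x : G, orderOf x = l :=
    fun l ⟨x, _, hx⟩ ↦ ⟨x, hx⟩
  rintro n (rfl | rfl | rfl | rfl | rfl)
  exacts [weak _ (key _ hp), weak _ (key _ hq), weak _ (key _ hr), key' q hq hpq.symm,
    key' r hr hpr.symm]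

/-- Characteristically simple groups which are not simple have at least six orbits. -/
theorem six_le_omegaAut_of_characteristic {G : Type*} [Group G] [Finite G]
    (h : ¬ Group.IsSolvable G) (hns : ¬ IsSimpleGroup G)
    (hchar : ∀ N : Subgroup G, N.Characteristic → N = ⊥ ∨ N = ⊤) : 6 ≤ omegaAut G := by
  obtain ⟨p, q, r, hp, hq, hr, hpq, hpr, hqr, hx⟩ := exists_orderOf_mul_of_characteristic h hns hchar
  have hmul : ∀ l m k : ℕ, l.Prime → m.Prime → k.Prime → l * m ≠ k := fun l m k hl hm hk he ↦
    Nat.not_prime_mul hl.ne_one hm.ne_one (he ▸ hk)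
  have hmul1 : ∀ l m : ℕ, l.Prime → 1 ≠ l * m := fun l m hl he ↦
    hl.ne_one (Nat.eq_one_of_mul_eq_one_right he.symm)
  have hcard : ({1, p, q, r, p * q, p * r} : Finset ℕ).card = 6 := by
    have h1 : p * q ≠ p * r := fun he ↦ hqr (Nat.eq_of_mul_eq_mul_left hp.pos he)
    simp [Finset.card_insert_of_notMem, hp.ne_one.symm, hq.ne_one.symm, hr.ne_one.symm, *,
      (hmul p q _ hp hq hp).symm, (hmul p q _ hp hq hq).symm, (hmul p q _ hp hq hr).symm,
      (hmul p r _ hp hr hp).symm, (hmul p r _ hp hr hq).symm, (hmul p r _ hp hr hr).symm]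
  refine hcard ▸ (card_le_omegaAut (fun x : G ↦ orderOf x) (fun α x ↦ α.orderOf_eq x) _ ?_).1
  intro n hn
  rw [Finset.mem_insert] at hn
  rcases hn with rfl | hn
  · exact ⟨1, orderOf_one⟩
  · exact hx n (by simpa using hn)

/-! ### Groups whose nontrivial orbits are determined by prime orders -/

theorem exists_orderOf_eq_of_mem_primeFactors {G : Type*} [Group G] [Finite G] {p : ℕ}
    (hp : p ∈ (Nat.card G).primeFactors) : ∃ x : G, orderOf x = p := by
  have : Fact p.Prime := ⟨Nat.prime_of_mem_primeFactors hp⟩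
  exact exists_prime_orderOf_dvd_card' p (Nat.dvd_of_mem_primeFactors hp)

/-- Nonsolvable groups with at most three prime divisors all of whose nontrivial elements have prime
order, the elements of each order forming a single automorphism orbit. -/
structure HasPrimeOrbits (H : Type*) [Group H] : Prop where
  not_isSolvable : ¬ Group.IsSolvable H
  prime_orderOf : ∀ x : H, x ≠ 1 → (orderOf x).Prime
  exists_mulAut : ∀ x y : H, orderOf x = orderOf y → ∃ α : MulAut H, α x = y
  card_primeFactors_le : (Nat.card H).primeFactors.card ≤ 3

namespace HasPrimeOrbits

variable {H : Type*} [Group H]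

theorem orderOf_eq_of_commute (h : HasPrimeOrbits H) {x y : H} (hx : x ≠ 1) (hy : y ≠ 1)
    (hc : Commute x y) : orderOf x = orderOf y := by
  by_contra hne
  have hpx := h.prime_orderOf x hx
  have hpy := h.prime_orderOf y hy
  have hm := hc.orderOf_mul_eq_mul_orderOf_of_coprime ((Nat.coprime_primes hpx hpy).2 hne)
  have h1 : x * y ≠ 1 := fun h1 ↦ by
    rw [h1, orderOf_one] at hm
    exact hpx.ne_one (Nat.eq_one_of_mul_eq_one_right hm.symm)
  exact Nat.not_prime_mul hpx.ne_one hpy.ne_one (hm ▸ h.prime_orderOf _ h1)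

theorem isPGroup_centralizer (h : HasPrimeOrbits H) {x : H} (hx : x ≠ 1) :
    IsPGroup (orderOf x) (Subgroup.centralizer {x}) := fun y ↦ by
  refine ⟨1, ?_⟩
  rcases eq_or_ne y 1 with rfl | hy
  · exact one_pow _
  have hc : Commute x y := Subgroup.mem_centralizer_singleton_iff.1 y.2 |>.symm
  rw [h.orderOf_eq_of_commute hx (by simpa using hy) hc, pow_one, Subgroup.orderOf_coe,
    pow_orderOf_eq_one]

theorem orderOf_eq_of_mem (h : HasPrimeOrbits H) {p : ℕ} [Fact p.Prime] {P : Subgroup H}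
    (hP : IsPGroup p P) {x : H} (hxP : x ∈ P) (hx : x ≠ 1) : orderOf x = p := by
  obtain ⟨k, hk⟩ := IsPGroup.iff_orderOf.1 hP ⟨x, hxP⟩
  rw [Subgroup.orderOf_mk] at hk
  exact (Nat.prime_dvd_prime_iff_eq (h.prime_orderOf x hx) Fact.out).1
    ((h.prime_orderOf x hx).dvd_of_dvd_pow hk.dvd)

theorem centralizer_eq (h : HasPrimeOrbits H) {p : ℕ} [Fact p.Prime] (P : Sylow p H) {x : H}
    (hxP : x ∈ P) (hx : x ≠ 1) (hPx : ∀ y ∈ P, Commute x y) :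
    Subgroup.centralizer {x} = P := by
  refine P.is_maximal' (h.orderOf_eq_of_mem P.isPGroup' hxP hx ▸ h.isPGroup_centralizer hx) ?_
  exact fun y hy ↦ Subgroup.mem_centralizer_singleton_iff.2 (hPx y hy).symm

variable [Finite H]

theorem primeFactors_eq (h : HasPrimeOrbits H) {K : Type*} [Group K] [Finite K]
    (hK : ¬ Group.IsSolvable K) (hd : Nat.card K ∣ Nat.card H) :
    (Nat.card K).primeFactors = (Nat.card H).primeFactors :=
  Finset.eq_of_subset_of_card_le (Nat.primeFactors_mono hd Nat.card_pos.ne')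
    (h.card_primeFactors_le.trans (three_le_card_primeFactors hK))

theorem mem_primeFactors (h : HasPrimeOrbits H) {x : H} (hx : x ≠ 1) :
    orderOf x ∈ (Nat.card H).primeFactors :=
  Nat.mem_primeFactors.2 ⟨h.prime_orderOf x hx, orderOf_dvd_natCard x, Nat.card_pos.ne'⟩

theorem isSimpleGroup (h : HasPrimeOrbits H) : IsSimpleGroup H := by
  by_contra hns
  obtain ⟨p, q, r, hp, hq, -, -, -, -, hx⟩ :=
    exists_orderOf_mul_of_characteristic h.not_isSolvable hns fun L hL ↦ by
      have hLs := h.not_isSolvable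
      rw [Group.isSolvable_iff_subgroup_quotient L, not_and_or] at hLs
      rcases hLs with hLs | hLs
      · right
        refine (Subgroup.eq_top_iff' L).2 fun x ↦ ?_
        rcases eq_or_ne x 1 with rfl | hx
        · exact one_mem L
        have hm := h.mem_primeFactors hx
        rw [← h.primeFactors_eq hLs (Subgroup.card_subgroup_dvd_card L)] at hm
        obtain ⟨y, hy⟩ := exists_orderOf_eq_of_mem_primeFactors hm
        rw [← Subgroup.orderOf_coe] at hy
        obtain ⟨α, rfl⟩ := h.exists_mulAut _ _ hy
        exact (hL.apply_mem_iff α).2 y.2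
      · left
        refine (Subgroup.eq_bot_iff_forall L).2 fun x hxL ↦ by_contra fun hx ↦ ?_
        have hm := h.mem_primeFactors hx
        rw [← h.primeFactors_eq hLs (Subgroup.card_quotient_dvd_card L)] at hm
        obtain ⟨y, hy⟩ := exists_orderOf_eq_of_mem_primeFactors hm
        obtain ⟨y, rfl⟩ := QuotientGroup.mk_surjective y
        have hyL : y ∉ L := fun hyL ↦ (h.prime_orderOf x hx).ne_one
          (by rw [← hy, (QuotientGroup.eq_one_iff y).2 hyL, orderOf_one])
        have hy1 : y ≠ 1 := fun h1 ↦ hyL (h1 ▸ one_mem L)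
        have hd : orderOf x ∣ orderOf y := hy ▸ orderOf_map_dvd (QuotientGroup.mk' L) y
        obtain ⟨α, hα⟩ := h.exists_mulAut _ _
          ((Nat.prime_dvd_prime_iff_eq (h.prime_orderOf x hx) (h.prime_orderOf y hy1)).1 hd)
        exact hyL (hα ▸ (hL.apply_mem_iff α).2 hxL)
  obtain ⟨x, hx⟩ := hx (p * q) (by simp)
  have hx1 : x ≠ 1 := by
    rintro rfl
    rw [orderOf_one] at hx
    exact hp.ne_one (Nat.eq_one_of_mul_eq_one_right hx.symm)
  exact Nat.not_prime_mul hp.ne_one hq.ne_one (hx ▸ h.prime_orderOf x hx1)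

theorem nontrivial_sylow {p : ℕ} [Fact p.Prime] (hp : p ∣ Nat.card H) (P : Sylow p H) :
    Nontrivial P :=
  Finite.one_lt_card_iff_nontrivial.1
    ((Fact.out : p.Prime).one_lt.trans_le (Nat.le_of_dvd Nat.card_pos (P.dvd_card_of_dvd_card hp)))

theorem exists_sylow_eq_centralizer (h : HasPrimeOrbits H) {p : ℕ} [Fact p.Prime] {x : H}
    (hx : orderOf x = p) : ∃ P : Sylow p H, (P : Subgroup H) = Subgroup.centralizer {x} := by
  have hx1 : x ≠ 1 := fun h1 ↦ (Fact.out : p.Prime).ne_one (by rw [← hx, h1, orderOf_one])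
  let P : Sylow p H := default
  have := nontrivial_sylow (hx ▸ orderOf_dvd_natCard x) P
  have := P.isPGroup'.center_nontrivial
  obtain ⟨z, hz⟩ := exists_ne (1 : Subgroup.center P)
  have hz1 : ((z : P) : H) ≠ 1 := by simpa using hz
  have hzP := h.centralizer_eq P (z : P).2 hz1 fun y hy ↦
    congrArg Subtype.val (Subgroup.mem_center_iff.1 z.2 ⟨y, hy⟩).symm
  obtain ⟨α, hα⟩ := h.exists_mulAut _ _
    ((h.orderOf_eq_of_mem P.isPGroup' (z : P).2 hz1).trans hx.symm)
  obtain ⟨Q, hQ⟩ := (hx ▸ h.isPGroup_centralizer hx1 :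
    IsPGroup p (Subgroup.centralizer {x})).exists_le_sylow
  refine ⟨Q, (Subgroup.eq_of_le_of_card_ge hQ ?_).symm⟩
  have hle : (P : Subgroup H).map α.toMonoidHom ≤ Subgroup.centralizer {x} := by
    rw [← hzP]
    rintro _ ⟨y, hy, rfl⟩
    rw [Subgroup.mem_centralizer_singleton_iff, ← hα]
    exact Commute.map (Subgroup.mem_centralizer_singleton_iff.1 hy : Commute y _) α
  calc Nat.card Q = Nat.card P := by rw [Q.card_eq_multiplicity, P.card_eq_multiplicity]
    _ = Nat.card ((P : Subgroup H).map α.toMonoidHom) :=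
      Nat.card_congr ((P : Subgroup H).equivMapOfInjective α.toMonoidHom α.injective).toEquiv
    _ ≤ _ := Subgroup.card_le_of_le hle

end HasPrimeOrbits

namespace HasPrimeOrbits

variable {H : Type*} [Group H]

theorem not_isMulCommutative (h : HasPrimeOrbits H) : ¬ ∀ x y : H, Commute x y := fun hc ↦
  h.not_isSolvable (Group.isSolvable_of_comm fun a b ↦ hc a b)

variable [Finite H]

theorem primeFactors_ne_singleton (h : HasPrimeOrbits H) {p : ℕ} :
    ¬ (Nat.card H).primeFactors ⊆ {p} := fun hs ↦ by
  have := (three_le_card_primeFactors h.not_isSolvable).trans (Finset.card_le_card hs)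
  simp at this

theorem sylow_ne_top (h : HasPrimeOrbits H) {p : ℕ} [Fact p.Prime] (P : Sylow p H) :
    (P : Subgroup H) ≠ ⊤ := fun htop ↦ by
  refine h.primeFactors_ne_singleton (p := p) fun r hr ↦ ?_
  obtain ⟨x, hx⟩ := exists_orderOf_eq_of_mem_primeFactors hr
  have hx1 : x ≠ 1 := fun h1 ↦ (Nat.prime_of_mem_primeFactors hr).ne_one
    (by rw [← hx, h1, orderOf_one])
  rw [← hx, h.orderOf_eq_of_mem P.isPGroup' (htop ▸ Subgroup.mem_top x) hx1]
  exact Finset.mem_singleton_self p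

/-- By transfer, a nontrivial abelian Sylow subgroup is not self-normalizing. -/
theorem relIndex_normalizer_ne_one (h : HasPrimeOrbits H) {p : ℕ} [Fact p.Prime] (P : Sylow p H)
    (hP : (P : Subgroup H) ≠ ⊥) (hcomm : ∀ x ∈ P, ∀ y ∈ P, Commute x y) :
    (P : Subgroup H).relIndex (Subgroup.normalizer (P : Set H)) ≠ 1 := fun h1 ↦ by
  have := h.isSimpleGroup
  have hle : Subgroup.normalizer (P : Set H) ≤ Subgroup.centralizer (P : Set H) :=
    (Subgroup.relIndex_eq_one.1 h1).trans fun x hx ↦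
      Subgroup.mem_centralizer_iff.2 fun y hy ↦ hcomm y hy x hx
  have hc := MonoidHom.ker_transferSylow_isComplement' P hle
  rcases (MonoidHom.transferSylow P hle).normal_ker.eq_bot_or_eq_top with hk | hk
  · rw [hk, Subgroup.isComplement'_bot_left] at hc
    exact h.sylow_ne_top P hc
  · rw [hk, Subgroup.isComplement'_top_left] at hc
    exact hP hc

theorem not_dvd_relIndex_normalizer {p : ℕ} [Fact p.Prime] (P : Sylow p H) :
    ¬ p ∣ (P : Subgroup H).relIndex (Subgroup.normalizer (P : Set H)) := fun hd ↦
  P.not_dvd_index (hd.trans (Subgroup.relIndex_dvd_index_of_le Subgroup.le_normalizer))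

theorem card_center_mul_le (h : HasPrimeOrbits H) (hodd : ¬ 2 ∣ Nat.card H) {p : ℕ}
    [Fact p.Prime] (hp : p ∣ Nat.card H) (P : Sylow p H) :
    3 * (Nat.card (Subgroup.center P) - 1) * Nat.card P ≤
      (Nat.card P - 1) * Nat.card (Subgroup.normalizer (P : Set H)) := by
  have h3 : ∀ n, n ∣ Nat.card H → n ≠ 1 → 3 ≤ n := fun n hn h1 ↦ by
    have h0 := Nat.pos_of_dvd_of_pos hn Nat.card_pos
    have h2 : n ≠ 2 := fun h2 ↦ hodd (h2 ▸ hn)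
    omega
  have hN := Subgroup.relIndex_mul_relIndex ⊥ (P : Subgroup H) (Subgroup.normalizer (P : Set H))
    bot_le Subgroup.le_normalizer
  rw [Subgroup.relIndex_bot_left, Subgroup.relIndex_bot_left, mul_comm] at hN
  have hPn := nontrivial_sylow hp P
  by_cases hcomm : ∀ x ∈ P, ∀ y ∈ P, Commute x y
  · have he := h3 _ (((P : Subgroup H).relIndex_dvd_index_of_le Subgroup.le_normalizer).trans
      (Subgroup.index_dvd_card _)) (h.relIndex_normalizer_ne_one P
        ((Subgroup.nontrivial_iff_ne_bot _).1 hPn) hcomm)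
    rw [← hN]
    have hle := Subgroup.card_le_card_group (Subgroup.center P)
    calc _ = (Nat.card (Subgroup.center P) - 1) * (3 * Nat.card P) := by ring
      _ ≤ _ := by gcongr; exact he
  · have hm := Subgroup.index_mul_card (Subgroup.center P)
    have he := h3 (Subgroup.center P).index ((Subgroup.index_dvd_card _).trans
      (Subgroup.card_subgroup_dvd_card _)) fun h1 ↦ hcomm fun x hx y hy ↦ by
        rw [Subgroup.index_eq_one] at h1
        exact congrArg Subtype.val
          (Subgroup.mem_center_iff.1 (h1 ▸ Subgroup.mem_top (⟨y, hy⟩ : P)) ⟨x, hx⟩)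
    have hle := Subgroup.card_le_of_le (Subgroup.le_normalizer (H := (P : Subgroup H)))
    have h4 : 3 * (Nat.card (Subgroup.center P) - 1) ≤ Nat.card P - 1 := by
      have := Nat.mul_le_mul_right (Nat.card (Subgroup.center P)) he
      omega
    exact Nat.mul_le_mul h4 hle

theorem three_mul_card_orderOf_eq_add_two_le (h : HasPrimeOrbits H) (hodd : ¬ 2 ∣ Nat.card H)
    {p : ℕ} (hp : p ∈ (Nat.card H).primeFactors) [Fintype H] [DecidableEq H] :
    3 * (Finset.univ.filter fun x : H ↦ orderOf x = p).card + 2 ≤ Nat.card H := by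
  have : Fact p.Prime := ⟨Nat.prime_of_mem_primeFactors hp⟩
  have hpd := Nat.dvd_of_mem_primeFactors hp
  have := Fintype.ofFinite (Sylow p H)
  let P₀ : Sylow p H := default
  have hcard : ∀ P : Sylow p H, Nat.card P = Nat.card P₀ := fun P ↦ by
    rw [P.card_eq_multiplicity, P₀.card_eq_multiplicity]
  have hnorm : ∀ P : Sylow p H,
      Fintype.card (Sylow p H) * Nat.card (Subgroup.normalizer (P : Set H)) = Nat.card H :=
    fun P ↦ by
      rw [← Nat.card_eq_fintype_card, P.card_eq_index_normalizer, Subgroup.index_mul_card]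
  set d := Nat.card P₀
  set s := Fintype.card (Sylow p H)
  have hd : 0 < d := Nat.card_pos
  have hs : 0 < s := Fintype.card_pos
  classical
  choose! f hf using fun (x : H) (hx : orderOf x = p) ↦ h.exists_sylow_eq_centralizer hx
  have hn := Finset.card_le_mul_card_image_of_maps_to (f := f)
    (s := Finset.univ.filter fun x : H ↦ orderOf x = p) (t := Finset.univ)
    (fun x _ ↦ Finset.mem_univ _) ((d - 1) * Nat.card H / (3 * d * s)) fun P _ ↦ by
      rw [Nat.le_div_iff_mul_le (by positivity)]
      have hfib : ((Finset.univ.filter fun x : H ↦ orderOf x = p).filter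
          fun x ↦ f x = P).card ≤ Nat.card (Subgroup.center P) - 1 := by
        have h1 : ((Finset.univ.filter fun x : H ↦ orderOf x = p).filter fun x ↦ f x = P) ⊆
            (((Subgroup.center P).map (P : Subgroup H).subtype : Set H).toFinset.erase 1) := by
          intro x hx
          simp only [Finset.mem_filter, Finset.mem_univ, true_and] at hx
          have hP : (P : Subgroup H) = Subgroup.centralizer {x} := hx.2 ▸ hf x hx.1
          refine Finset.mem_erase.2 ⟨fun h1 ↦ (Fact.out : p.Prime).ne_one
            (by rw [← hx.1, h1, orderOf_one]), ?_⟩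
          rw [Set.mem_toFinset]
          refine ⟨⟨x, by rw [hP]; exact Subgroup.mem_centralizer_singleton_iff.2 rfl⟩,
            Subgroup.mem_center_iff.2 fun y ↦ Subtype.ext ?_, rfl⟩
          exact Subgroup.mem_centralizer_singleton_iff.1 (hP ▸ y.2)
        refine (Finset.card_le_card h1).trans ?_
        rw [Finset.card_erase_of_mem (Set.mem_toFinset.2 (one_mem _)), Set.toFinset_card,
          ← Nat.card_eq_fintype_card]
        exact Nat.sub_le_sub_right (Nat.card_congr ((Subgroup.center P).equivMapOfInjective _
          (P : Subgroup H).subtype_injective).toEquiv).ge 1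
      calc _ ≤ (Nat.card (Subgroup.center P) - 1) * (3 * d * s) := Nat.mul_le_mul_right _ hfib
        _ = 3 * (Nat.card (Subgroup.center P) - 1) * Nat.card P * s := by rw [hcard]; ring
        _ ≤ (Nat.card P - 1) * Nat.card (Subgroup.normalizer (P : Set H)) * s :=
          Nat.mul_le_mul_right _ (h.card_center_mul_le hodd hpd P)
        _ = _ := by rw [hcard, ← hnorm P]; ring
  rw [Finset.card_univ] at hn
  set n := (Finset.univ.filter fun x : H ↦ orderOf x = p).card
  have h1 : n * (3 * d) ≤ (d - 1) * Nat.card H := by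
    refine Nat.le_of_mul_le_mul_right ?_ hs
    calc n * (3 * d) * s ≤ (d - 1) * Nat.card H / (3 * d * s) * s * (3 * d) * s := by
          exact Nat.mul_le_mul_right _ (Nat.mul_le_mul_right _ hn)
      _ = ((d - 1) * Nat.card H / (3 * d * s)) * (3 * d * s) * s := by ring
      _ ≤ _ := Nat.mul_le_mul_right _ (Nat.div_mul_le_self _ _)
  obtain ⟨k, hk⟩ := Subgroup.card_subgroup_dvd_card (P₀ : Subgroup H)
  change Nat.card H = d * k at hk
  have hk1 : k ≠ 1 := fun hk1 ↦ h.sylow_ne_top P₀ (Subgroup.card_eq_iff_eq_top _ |>.1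
    (by rw [hk, hk1, mul_one]))
  have hk0 : k ≠ 0 := by
    rintro rfl
    exact Nat.card_pos.ne' hk
  obtain ⟨e, he⟩ := Nat.exists_eq_add_of_lt hd
  have h2 : n * 3 ≤ (d - 1) * k := by
    refine Nat.le_of_mul_le_mul_right ?_ hd
    calc n * 3 * d = n * (3 * d) := by ring
      _ ≤ _ := h1
      _ = _ := by rw [hk]; ring
  rw [hk]
  rw [Nat.sub_mul, one_mul] at h2
  have : k ≤ d * k := Nat.le_mul_of_pos_left _ hd
  omega

theorem two_dvd_card (h : HasPrimeOrbits H) : 2 ∣ Nat.card H := by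
  classical
  by_contra hodd
  have := Fintype.ofFinite H
  have hmaps : ∀ x ∈ (Finset.univ : Finset H), orderOf x ∈ insert 1 (Nat.card H).primeFactors :=
    fun x _ ↦ by
      rcases eq_or_ne x 1 with rfl | hx
      · simp
      · exact Finset.mem_insert_of_mem (h.mem_primeFactors hx)
  have hcard := Finset.card_eq_sum_card_fiberwise hmaps
  have h1 : (Finset.univ.filter fun x : H ↦ orderOf x = 1).card = 1 := by
    rw [Finset.card_eq_one]
    exact ⟨1, by ext; simp⟩
  rw [Finset.card_univ, ← Nat.card_eq_fintype_card, Finset.sum_insert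
    (fun h1 ↦ (Nat.prime_of_mem_primeFactors h1).ne_one rfl), h1] at hcard
  have h3 := h.card_primeFactors_le.antisymm (three_le_card_primeFactors h.not_isSolvable)
  have hsum := Finset.sum_le_sum fun p (hp : p ∈ (Nat.card H).primeFactors) ↦
    h.three_mul_card_orderOf_eq_add_two_le hodd hp
  rw [Finset.sum_add_distrib, ← Finset.mul_sum, Finset.sum_const, Finset.sum_const, h3,
    smul_eq_mul, smul_eq_mul] at hsum
  omega

theorem exists_involution_inverting (h : HasPrimeOrbits H) : ∃ t x : H,
    orderOf t = 2 ∧ (orderOf x).Prime ∧ orderOf x ≠ 2 ∧ t * x * t⁻¹ = x⁻¹ := by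
  have := h.isSimpleGroup
  have : Fact (Nat.Prime 2) := ⟨Nat.prime_two⟩
  obtain ⟨t₀, ht₀⟩ := exists_prime_orderOf_dvd_card' 2 h.two_dvd_card
  obtain ⟨s, t, hs, ht, hst⟩ : ∃ s t : H, orderOf s = 2 ∧ orderOf t = 2 ∧ ¬ Commute s t := by
    by_contra! hall
    have hN : (Subgroup.closure {x : H | orderOf x = 2}).Normal := by
      refine Subgroup.normalizer_eq_top_iff.1 (top_le_iff.1 ?_)
      refine Subgroup.le_normalizer_closure_iff.2 fun g _ x hx ↦ Subgroup.subset_closure ?_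
      exact ((MulAut.conj g).orderOf_eq x).trans hx
    have ht : Subgroup.closure {x : H | orderOf x = 2} = ⊤ :=
      hN.eq_bot_or_eq_top.resolve_left fun hb ↦ by
        have := Subgroup.subset_closure (show t₀ ∈ {x : H | orderOf x = 2} from ht₀)
        rw [hb, SetLike.mem_coe, Subgroup.mem_bot] at this
        rw [this, orderOf_one] at ht₀
        omega
    have hc := Subgroup.isMulCommutative_closure (k := {x : H | orderOf x = 2})
      fun x hx y hy ↦ hall x y hx hy
    rw [ht] at hc
    refine h.not_isMulCommutative fun x y ↦ ?_
    exact congrArg Subtype.val (mul_comm' (⟨x, Subgroup.mem_top x⟩ : (⊤ : Subgroup H)) ⟨y, Subgroup.mem_top y⟩)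
  have hs' : s⁻¹ = s := inv_eq_of_mul_eq_one_left (by rw [← sq, ← hs, pow_orderOf_eq_one])
  have ht' : t⁻¹ = t := inv_eq_of_mul_eq_one_left (by rw [← sq, ← ht, pow_orderOf_eq_one])
  refine ⟨t, s * t, ht, h.prime_orderOf _ fun h1 ↦ ?_, fun h2 ↦ ?_, ?_⟩
  · rw [mul_eq_one_iff_eq_inv, ht'] at h1
    exact hst (h1 ▸ Commute.refl _)
  · have h3 : (s * t) * (s * t) = 1 := by rw [← sq, ← h2, pow_orderOf_eq_one]
    have h4 := eq_inv_of_mul_eq_one_left h3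
    rw [mul_inv_rev, hs', ht'] at h4
    exact hst h4
  · rw [mul_inv_rev, hs', ht', ← mul_assoc, mul_assoc, ← sq, ← ht, pow_orderOf_eq_one, mul_one]

end HasPrimeOrbits

/-! ### A characteristic subgroup with nonsolvable quotient -/

theorem Subgroup.Characteristic.orderOf_mk_apply {G : Type*} [Group G] {N : Subgroup G} [N.Normal]
    (hN : N.Characteristic) (α : MulAut G) (x : G) :
    orderOf (α x : G ⧸ N) = orderOf (x : G ⧸ N) := by
  refine orderOf_eq_orderOf_iff.2 fun n ↦ ?_
  rw [← QuotientGroup.mk_pow, ← QuotientGroup.mk_pow, QuotientGroup.eq_one_iff,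
    QuotientGroup.eq_one_iff, ← map_pow, hN.apply_mem_iff]

theorem forall_commute_of_mulAut_transitive {G : Type*} [Group G] [Finite G] {N : Subgroup G}
    (hN : N.Characteristic) (hbot : N ≠ ⊥)
    (htrans : ∀ x ∈ N, ∀ y ∈ N, x ≠ 1 → y ≠ 1 → ∃ α : MulAut G, α x = y) :
    (∃ p : ℕ, p.Prime ∧ ∀ x ∈ N, x ^ p = 1) ∧ ∀ x ∈ N, ∀ y ∈ N, Commute x y := by
  have hcard : Nat.card N ≠ 1 := ((Subgroup.one_lt_card_iff_ne_bot N).2 hbot).ne'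
  obtain ⟨p, hp, hpd⟩ := Nat.exists_prime_and_dvd hcard
  have : Fact p.Prime := ⟨hp⟩
  obtain ⟨x₀, hx₀⟩ := exists_prime_orderOf_dvd_card' p hpd
  have hx₀1 : (x₀ : G) ≠ 1 := fun h1 ↦ hp.ne_one
    (by rw [← hx₀, ← Subgroup.orderOf_coe, h1, orderOf_one])
  have hpow : ∀ x ∈ N, x ^ p = 1 := fun x hx ↦ by
    rcases eq_or_ne x 1 with rfl | hx1
    · exact one_pow _
    obtain ⟨α, rfl⟩ := htrans x₀ x₀.2 x hx hx₀1 hx1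
    rw [← map_pow, ← hx₀, ← Subgroup.orderOf_coe, pow_orderOf_eq_one, map_one]
  refine ⟨⟨p, hp, hpow⟩, fun x hx y hy ↦ ?_⟩
  rcases eq_or_ne x 1 with rfl | hx1
  · exact Commute.one_left y
  have hNp : IsPGroup p N := fun x ↦ ⟨1, Subtype.ext (by simpa using hpow x x.2)⟩
  have : Nontrivial N := (Subgroup.nontrivial_iff_ne_bot N).2 hbot
  have := hNp.center_nontrivial
  obtain ⟨z, hz⟩ := exists_ne (1 : Subgroup.center N)
  have hz1 : ((z : N) : G) ≠ 1 := by simpa using hz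
  obtain ⟨α, rfl⟩ := htrans _ (z : N).2 x hx hz1 hx1
  have hy' : α⁻¹ y ∈ N := (hN.apply_mem_iff α⁻¹).2 hy
  have hc : Commute ((z : N) : G) (α⁻¹ y) :=
    congrArg Subtype.val (Subgroup.mem_center_iff.1 z.2 ⟨_, hy'⟩).symm
  simpa using hc.map α

theorem commute_of_forall_commute {G : Type*} [Group G] {N : Subgroup G} [N.Normal]
    (hs : IsSimpleGroup (G ⧸ N)) (hcomm : ∀ x ∈ N, ∀ y ∈ N, Commute x y) {y : G} (hy : y ∉ N)
    (hyN : ∀ n ∈ N, Commute y n) (g : G) {n : G} (hn : n ∈ N) : Commute g n := by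
  let C := Subgroup.centralizer (N : Set G)
  have hC : (C.map (QuotientGroup.mk' N)).Normal :=
    Subgroup.Normal.map inferInstance _ (QuotientGroup.mk'_surjective N)
  have hyC : y ∈ C := Subgroup.mem_centralizer_iff.2 fun n hn ↦ (hyN n hn).symm
  have htop : C.map (QuotientGroup.mk' N) = ⊤ := hC.eq_bot_or_eq_top.resolve_left fun hb ↦ by
    have := Subgroup.mem_map_of_mem (QuotientGroup.mk' N) hyC
    rw [hb, Subgroup.mem_bot] at this
    exact hy ((QuotientGroup.eq_one_iff y).1 this)
  obtain ⟨c, hc, hcg⟩ : (g : G ⧸ N) ∈ C.map (QuotientGroup.mk' N) := htop ▸ Subgroup.mem_top _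
  have h1 : c⁻¹ * g ∈ N := QuotientGroup.eq.1 hcg
  have h2 : Commute c n := (Subgroup.mem_centralizer_iff.1 hc n hn).symm
  simpa using h2.mul_left (hcomm _ h1 n hn)

theorem false_of_lifts {G : Type*} [Group G] [Finite G] {N : Subgroup G} [N.Normal]
    (hbot : N ≠ ⊥) (hH : HasPrimeOrbits (G ⧸ N)) {p : ℕ} (hp : p.Prime)
    (hpow : ∀ x ∈ N, x ^ p = 1) (hcomm : ∀ x ∈ N, ∀ y ∈ N, Commute x y)
    (hlift : ∀ x y : G, x ∉ N → orderOf (x : G ⧸ N) = orderOf (y : G ⧸ N) →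
      ∃ α : MulAut G, α x = y) : False := by
  have hs := hH.isSimpleGroup
  obtain ⟨n₀, hn₀, hn₀1⟩ := (Subgroup.bot_or_exists_ne_one N).resolve_left hbot
  obtain ⟨t, x, ht, hm, hm2, htx⟩ := hH.exists_involution_inverting
  obtain ⟨t, rfl⟩ := QuotientGroup.mk_surjective t
  obtain ⟨x, rfl⟩ := QuotientGroup.mk_surjective x
  have hmem : ∀ y : G, orderOf (y : G ⧸ N) ≠ 1 → y ∉ N := fun y hy hyN ↦ hy
    (by rw [(QuotientGroup.eq_one_iff y).2 hyN, orderOf_one])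
  have htN : t ∉ N := hmem t (by omega)
  have hxN : x ∉ N := hmem x hm.ne_one
  have hpowN : ∀ y : G, y ^ orderOf (y : G ⧸ N) ∈ N := fun y ↦ by
    rw [← QuotientGroup.eq_one_iff, QuotientGroup.mk_pow, pow_orderOf_eq_one]
  -- equations between powers are shared by all lifts of elements of the same order
  have htransfer : ∀ (y z : G) (k : ℕ), y ∉ N → orderOf (y : G ⧸ N) = orderOf (z : G ⧸ N) →
      y ^ k = 1 → z ^ k = 1 := fun y z k hy hyz hk ↦ by
    obtain ⟨α, rfl⟩ := hlift y z hy hyz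
    rw [← map_pow, hk, map_one]
  have hmul : ∀ (y n : G), n ∈ N → ((y * n : G) : G ⧸ N) = y := fun y n hn ↦ by
    rw [QuotientGroup.mk_mul, (QuotientGroup.eq_one_iff n).2 hn, mul_one]
  have hinv : (∀ y : G, orderOf (y : G ⧸ N) = 2 → y ^ 2 = 1) →
      ∀ y n : G, orderOf (y : G ⧸ N) = 2 → n ∈ N → y * n * y⁻¹ = n⁻¹ := fun h y n hy hn ↦ by
    have h1 : y⁻¹ = y := inv_eq_of_mul_eq_one_left (by rw [← sq, h y hy])
    have h2 := h (y * n) (by rwa [hmul y n hn])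
    rw [h1, eq_inv_iff_mul_eq_one, ← h2, sq, mul_assoc (y * n)]
  rcases hp.eq_two_or_odd' with rfl | hodd
  · have hmodd := hm.odd_of_ne_two hm2
    have hxm : ∀ y : G, orderOf (y : G ⧸ N) = orderOf (x : G ⧸ N) →
        y ^ orderOf (x : G ⧸ N) = 1 := fun y hy ↦ by
      set m := orderOf (x : G ⧸ N)
      have hx' : ((x ^ (m + 1) : G) : G ⧸ N) = x := by
        rw [pow_succ', hmul _ _ (hpowN x)]
      refine htransfer (x ^ (m + 1)) y m (hmem _ ?_) ?_ ?_
      · rw [hx']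
        exact hm.ne_one
      · rw [hx', hy]
      · obtain ⟨k, hk⟩ := hmodd.add_one
        rw [← pow_mul, mul_comm, pow_mul, hk, ← two_mul, pow_mul, hpow _ (hpowN x), one_pow]
    have hfix : ∀ n ∈ N, Commute x n → n = 1 := fun n hn hc ↦ by
      have h1 := hxm (x * n) (by rw [hmul x n hn])
      obtain ⟨k, hk⟩ := hmodd
      rwa [hc.mul_pow, hxm x rfl, one_mul, hk, pow_succ, pow_mul, hpow n hn, one_pow,
        one_mul] at h1
    have ht2 : t ^ 2 ≠ 1 := fun ht2 ↦ by
      refine hn₀1 (hfix n₀ hn₀ (commute_of_forall_commute hs hcomm htN (fun n hn ↦ ?_) x hn₀))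
      have h1 := hinv (fun y hy ↦ htransfer t y 2 htN (ht.trans hy.symm) ht2) t n ht hn
      have h2 : n⁻¹ = n := inv_eq_of_mul_eq_one_left (by rw [← sq, hpow n hn])
      rw [h2, mul_inv_eq_iff_eq_mul] at h1
      exact h1
    have hinj : Function.Injective fun n : N ↦ (⟨n * (x * (n : G)⁻¹ * x⁻¹),
        mul_mem n.2 (Subgroup.Normal.conj_mem inferInstance _ (inv_mem n.2) x)⟩ : N) := by
      intro n k hnk
      have h1 : (n : G) * (x * (n : G)⁻¹ * x⁻¹) = k * (x * (k : G)⁻¹ * x⁻¹) :=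
        congrArg Subtype.val hnk
      have h2 : (k : G)⁻¹ * n = 1 := hfix _ (mul_mem (inv_mem k.2) n.2) <| by
        change x * ((k : G)⁻¹ * n) = (k : G)⁻¹ * n * x
        have h3 := congrArg (fun g ↦ (k : G)⁻¹ * g * x * n) h1
        simp only [mul_assoc, inv_mul_cancel_left, inv_mul_cancel, mul_one] at h3 ⊢
        exact h3.symm
      exact Subtype.ext (inv_mul_eq_one.1 h2).symm
    have hyN : t * x⁻¹ * t⁻¹ * x⁻¹ ∈ N := by
      rw [← QuotientGroup.eq_one_iff]
      have := congrArg (·⁻¹) htx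
      simp only [mul_inv_rev, inv_inv] at this
      simp only [QuotientGroup.mk_mul, QuotientGroup.mk_inv]
      rw [mul_assoc (t : G ⧸ N), this, mul_inv_cancel]
    obtain ⟨n, hn⟩ := (Finite.surjective_of_injective hinj) ⟨_, hyN⟩
    have hn' : (n : G) * (x * (n : G)⁻¹ * x⁻¹) = t * x⁻¹ * t⁻¹ * x⁻¹ := congrArg Subtype.val hn
    have hmk : (((n : G)⁻¹ * t : G) : G ⧸ N) = t := by
      rw [QuotientGroup.mk_mul, (QuotientGroup.eq_one_iff _).2 (inv_mem n.2), one_mul]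
    set t' := (n : G)⁻¹ * t with ht'
    have h1 : t' * x⁻¹ * t'⁻¹ = x := by
      have h2 : t * x⁻¹ * t⁻¹ = n * x * (n : G)⁻¹ := by
        rw [← mul_left_inj x⁻¹, ← hn']
        group
      calc t' * x⁻¹ * t'⁻¹ = (n : G)⁻¹ * (t * x⁻¹ * t⁻¹) * n := by rw [ht']; group
        _ = x := by rw [h2]; group
    have h2 : t' ^ 2 = 1 := by
      refine hfix _ ?_ ?_
      · have := hpowN t'
        rwa [hmk, ht] at this
      · have h3 : t' * x * t'⁻¹ = x⁻¹ := by
          have := congrArg (·⁻¹) h1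
          simpa [mul_assoc] using this
        have h4 : t' ^ 2 * x⁻¹ * (t' ^ 2)⁻¹ = x⁻¹ := by
          calc t' ^ 2 * x⁻¹ * (t' ^ 2)⁻¹ = t' * (t' * x⁻¹ * t'⁻¹) * t'⁻¹ := by
                rw [sq]; group
            _ = x⁻¹ := by rw [h1, h3]
        rw [mul_inv_eq_iff_eq_mul] at h4
        exact (Commute.inv_right_iff.1 (h4 : Commute (t' ^ 2) x⁻¹)).symm
    exact ht2 (htransfer t' t 2 (hmem _ (by rw [hmk]; omega)) (by rw [hmk]) h2)
  · have hsq : ∀ y : G, orderOf (y : G ⧸ N) = 2 → y ^ 2 = 1 := fun y hy ↦ by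
      have htN2 := hpowN t
      rw [ht] at htN2
      have hmk : ((t ^ p : G) : G ⧸ N) = t := by
        obtain ⟨k, hk⟩ := hodd
        rw [hk, pow_succ', pow_mul, hmul _ _ (pow_mem htN2 k)]
      refine htransfer (t ^ p) y 2 (hmem _ (by rw [hmk]; omega)) (by rw [hmk, ht, hy]) ?_
      rw [← pow_mul, mul_comm, pow_mul, hpow _ htN2]
    have hst : orderOf ((x * t : G) : G ⧸ N) = 2 := by
      refine orderOf_eq_prime ?_ fun h1 ↦ ?_
      · have h2 : (t : G ⧸ N) ^ 2 = 1 := by rw [← ht, pow_orderOf_eq_one]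
        calc (x * t : G ⧸ N) ^ 2 = x * (t * x * (t : G ⧸ N)⁻¹) * (t : G ⧸ N) ^ 2 := by
              rw [sq, sq]; group
          _ = 1 := by rw [htx, h2, mul_inv_cancel, one_mul]
      · rw [QuotientGroup.mk_mul, mul_eq_one_iff_eq_inv] at h1
        rw [h1, orderOf_inv, ht] at hm2
        exact hm2 rfl
    have hxc : ∀ n ∈ N, Commute x n := fun n hn ↦ by
      have h1 := hinv hsq t n⁻¹ ht (inv_mem hn)
      have h2 := hinv hsq (x * t) n⁻¹ hst (inv_mem hn)
      have h3 : x * (t * n⁻¹ * t⁻¹) * x⁻¹ = n⁻¹⁻¹ := by rw [← h2]; group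
      rw [h1, inv_inv, mul_inv_eq_iff_eq_mul] at h3
      exact h3
    have h1 := hinv hsq t n₀ ht hn₀
    rw [(commute_of_forall_commute hs hcomm hxN hxc t hn₀).eq, mul_inv_cancel_right,
      eq_inv_iff_mul_eq_one, ← sq] at h1
    obtain ⟨k, hk⟩ := hodd
    have h2 := hpow n₀ hn₀
    rw [hk, pow_succ, pow_mul, h1, one_pow, one_mul] at h2
    exact hn₀1 h2

theorem six_le_omegaAut_of_quotient {G : Type*} [Group G] [Finite G] {N : Subgroup G} [N.Normal]
    (hN : N.Characteristic) (hbot : N ≠ ⊥) (hs : ¬ Group.IsSolvable (G ⧸ N)) :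
    6 ≤ omegaAut G := by
  classical
  by_contra! hlt
  let c : G → ℕ := fun x ↦ if x = 1 then 0 else orderOf (x : G ⧸ N)
  have hc1 : ∀ x : G, x ≠ 1 → c x = orderOf (x : G ⧸ N) := fun x hx ↦ if_neg hx
  have hcN : ∀ x ∈ N, x ≠ 1 → c x = 1 := fun x hx hx1 ↦ by
    rw [hc1 x hx1, (QuotientGroup.eq_one_iff x).2 hx, orderOf_one]
  set T := (Nat.card (G ⧸ N)).primeFactors
  have h1T : 1 ∉ T := fun h1 ↦ (Nat.prime_of_mem_primeFactors h1).ne_one rfl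
  have h0T : 0 ∉ insert 1 T := fun h0 ↦ by
    rcases Finset.mem_insert.1 h0 with h0 | h0
    · exact zero_ne_one h0
    · exact (Nat.prime_of_mem_primeFactors h0).ne_zero rfl
  have hcard : (insert 0 (insert 1 T)).card = T.card + 2 := by
    rw [Finset.card_insert_of_notMem h0T, Finset.card_insert_of_notMem h1T]
  have hT : 3 ≤ T.card := three_le_card_primeFactors hs
  obtain ⟨hle, hsep⟩ := card_le_omegaAut c (fun α x ↦ by
      simp only [c, hN.orderOf_mk_apply, EmbeddingLike.map_eq_one_iff]) (insert 0 (insert 1 T))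
    fun n hn ↦ by
      rcases Finset.mem_insert.1 hn with rfl | hn
      · exact ⟨1, if_pos rfl⟩
      rcases Finset.mem_insert.1 hn with rfl | hn
      · obtain ⟨x, hx, hx1⟩ := (Subgroup.bot_or_exists_ne_one N).resolve_left hbot
        exact ⟨x, hcN x hx hx1⟩
      · obtain ⟨x, hx⟩ := exists_orderOf_eq_of_mem_primeFactors hn
        obtain ⟨x, rfl⟩ := QuotientGroup.mk_surjective x
        refine ⟨x, (hc1 x fun h1 ↦ (Nat.prime_of_mem_primeFactors hn).ne_one ?_).trans hx⟩
        rw [← hx, h1, QuotientGroup.mk_one, orderOf_one]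
  obtain ⟨hmem, hsep⟩ := hsep (by omega)
  have hlift : ∀ x y : G, x ∉ N → orderOf (x : G ⧸ N) = orderOf (y : G ⧸ N) →
      ∃ α : MulAut G, α x = y := fun x y hx hxy ↦ by
    refine hsep x y ?_
    rw [hc1 x (fun h1 ↦ hx (h1 ▸ one_mem N)), hc1 y, hxy]
    rintro rfl
    rw [QuotientGroup.mk_one, orderOf_one, orderOf_eq_one_iff, QuotientGroup.eq_one_iff] at hxy
    exact hx hxy
  have hH : HasPrimeOrbits (G ⧸ N) :=
    { not_isSolvable := hs
      prime_orderOf := fun x hx ↦ by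
        obtain ⟨x, rfl⟩ := QuotientGroup.mk_surjective x
        have hx1 : x ≠ 1 := fun h1 ↦ hx (h1 ▸ rfl)
        have h1 := hmem x
        have h2 : orderOf (x : G ⧸ N) ≠ 1 := fun h ↦ hx (orderOf_eq_one_iff.1 h)
        have h3 : orderOf (x : G ⧸ N) ≠ 0 := (orderOf_pos _).ne'
        rw [hc1 x hx1, Finset.mem_insert, Finset.mem_insert] at h1
        exact Nat.prime_of_mem_primeFactors ((h1.resolve_left h3).resolve_left h2)
      exists_mulAut := fun x y hxy ↦ by
        rcases eq_or_ne x 1 with rfl | hx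
        · rw [orderOf_one, eq_comm, orderOf_eq_one_iff] at hxy
          exact ⟨1, hxy.symm⟩
        obtain ⟨x, rfl⟩ := QuotientGroup.mk_surjective x
        obtain ⟨y, rfl⟩ := QuotientGroup.mk_surjective y
        obtain ⟨α, rfl⟩ := hlift x y (fun hxN ↦ hx ((QuotientGroup.eq_one_iff x).2 hxN)) hxy
        exact ⟨QuotientGroup.congr N N α (Subgroup.characteristic_iff_map_eq.1 hN α), rfl⟩
      card_primeFactors_le := show T.card ≤ 3 by omega }
  obtain ⟨⟨p, hp, hpow⟩, hcomm⟩ := forall_commute_of_mulAut_transitive hN hbot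
    fun x hx y hy hx1 hy1 ↦ hsep x y ((hcN x hx hx1).trans (hcN y hy hy1).symm)
  exact false_of_lifts hbot hH hp hpow hcomm hlift

/-! ### A nonsolvable characteristic subgroup -/

/-- A form of the Frattini argument. -/
theorem Sylow.exists_mem_normalizer_notMem {G : Type*} [Group G] [Finite G] {N : Subgroup G}
    [N.Normal] {p : ℕ} [Fact p.Prime] (P : Sylow p N) {g : G} (hg : g ∉ N) :
    ∃ k ∉ N, k ∈ Subgroup.normalizer ((P : Subgroup N).map N.subtype : Set G) := by
  obtain ⟨k, hk, n, hn, rfl⟩ := Subgroup.mem_sup_of_normal_right.1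
    (P.normalizer_sup_eq_top ▸ Subgroup.mem_top g)
  exact ⟨k, fun hkN ↦ hg (mul_mem hkN hn), hk⟩

theorem exists_isPGroup_normalized {G : Type*} [Group G] [Finite G] {S K : Subgroup G} [S.Normal]
    {p : ℕ} [Fact p.Prime] {g x : G} (hgK : g ∈ K) (hgS : g ∉ S) (hxK : x ∈ K) (hxS : x ∈ S)
    (hx : orderOf x = p) : ∃ R ≤ K ⊓ S, IsPGroup p R ∧ R ≠ ⊥ ∧
      ∃ k ∈ K, k ∉ S ∧ ∀ y ∈ R, k * y * k⁻¹ ∈ R := by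
  let P : Sylow p (S.subgroupOf K) := default
  obtain ⟨k, hk, hkP⟩ := P.exists_mem_normalizer_notMem (g := ⟨g, hgK⟩)
    (by rwa [Subgroup.mem_subgroupOf])
  rw [Subgroup.mem_subgroupOf] at hk
  refine ⟨((P : Subgroup (S.subgroupOf K)).map (S.subgroupOf K).subtype).map K.subtype, ?_, ?_, ?_,
    k, k.2, hk, ?_⟩
  · rintro _ ⟨_, ⟨y, -, rfl⟩, rfl⟩
    exact ⟨(y : K).2, Subgroup.mem_subgroupOf.1 y.2⟩
  · exact (P.isPGroup'.map _).map _
  · rw [Ne, Subgroup.map_eq_bot_iff_of_injective _ K.subtype_injective,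
      Subgroup.map_eq_bot_iff_of_injective _ (Subgroup.subtype_injective _), ← Ne,
      ← Subgroup.nontrivial_iff_ne_bot]
    refine HasPrimeOrbits.nontrivial_sylow ?_ P
    have := orderOf_dvd_natCard (⟨⟨x, hxK⟩, Subgroup.mem_subgroupOf.2 hxS⟩ : S.subgroupOf K)
    rwa [Subgroup.orderOf_mk, Subgroup.orderOf_mk, hx] at this
  · rintro _ ⟨y, hy, rfl⟩
    exact ⟨k * y * k⁻¹, (Subgroup.mem_normalizer_iff.1 hkP y).1 hy, rfl⟩

/-- If all elements outside a proper normal subgroup have the same order, then this order is a power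
of a prime `l` with `l`-th powers in the subgroup. -/
theorem exists_orderOf_eq_prime_pow {G : Type*} [Group G] [Finite G] {S : Subgroup G} [S.Normal]
    {g₀ : G} (hg₀ : g₀ ∉ S) (hout : ∀ x y, x ∉ S → y ∉ S → orderOf x = orderOf y) :
    ∃ l a : ℕ, l.Prime ∧ ∀ x ∉ S, orderOf x = l ^ a ∧ x ^ l ∈ S := by
  obtain ⟨l, hl, hld⟩ := Nat.exists_prime_and_dvd (n := orderOf (g₀ : G ⧸ S))
    (by rwa [Ne, orderOf_eq_one_iff, QuotientGroup.eq_one_iff])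
  have hne := (orderOf_pos g₀).ne'
  obtain ⟨a, b, hb, hab⟩ := Nat.exists_eq_pow_mul_and_not_dvd hne l hl.ne_one
  have hgb : g₀ ^ b ∉ S := fun hS ↦ by
    rw [← QuotientGroup.eq_one_iff, QuotientGroup.mk_pow] at hS
    exact hb (hld.trans (orderOf_dvd_of_pow_eq_one hS))
  have hord : orderOf (g₀ ^ b) = l ^ a := by
    have hb0 : b ≠ 0 := fun h0 ↦ hb (h0 ▸ dvd_zero l)
    rw [orderOf_pow_of_dvd hb0 (hab ▸ dvd_mul_left b _), hab,
      Nat.mul_div_cancel _ (Nat.pos_of_ne_zero hb0)]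
  have hall : ∀ x ∉ S, orderOf x = l ^ a := fun x hx ↦ (hout x _ hx hgb).trans hord
  refine ⟨l, a, hl, fun x hx ↦ ⟨hall x hx, by_contra fun hxl ↦ ?_⟩⟩
  have ha : a ≠ 0 := by
    rintro rfl
    have := hall x hx
    rw [pow_zero, orderOf_eq_one_iff] at this
    exact hx (this ▸ one_mem S)
  have h1 : (x ^ l) ^ l ^ (a - 1) = 1 := by
    rw [← pow_mul, ← pow_succ', Nat.sub_add_cancel (Nat.pos_of_ne_zero ha), ← hall x hx,
      pow_orderOf_eq_one]
  have h2 := orderOf_dvd_of_pow_eq_one h1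
  rw [hall _ hxl, Nat.pow_dvd_pow_iff_le_right hl.one_lt] at h2
  omega

/-- A group in which an element inverts a normal subgroup. -/
theorem commute_of_forall_conj_eq_inv {G : Type*} [Group G] {S : Subgroup G} {g : G}
    (h : ∀ s ∈ S, g * s * g⁻¹ = s⁻¹) {x y : G} (hx : x ∈ S) (hy : y ∈ S) : Commute x y := by
  have h1 := h (y⁻¹ * x⁻¹) (mul_mem (inv_mem hy) (inv_mem hx))
  have h2 : g * (y⁻¹ * x⁻¹) * g⁻¹ = (g * y⁻¹ * g⁻¹) * (g * x⁻¹ * g⁻¹) := by group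
  rw [h2, h _ (inv_mem hy), h _ (inv_mem hx)] at h1
  rw [inv_inv, inv_inv, mul_inv_rev, inv_inv, inv_inv] at h1
  exact h1.symm

section

variable {G : Type*} [Group G] {S : Subgroup G}

theorem HasPrimeOrbits.prime_orderOf_of_mem (h : HasPrimeOrbits S) {x : G} (hx : x ∈ S)
    (hx1 : x ≠ 1) : (orderOf x).Prime := by
  have := h.prime_orderOf ⟨x, hx⟩ (by simpa using hx1)
  rwa [Subgroup.orderOf_mk] at this

theorem HasPrimeOrbits.orderOf_eq_of_commute_of_mem (h : HasPrimeOrbits S) {x y : G} (hx : x ∈ S)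
    (hy : y ∈ S) (hx1 : x ≠ 1) (hy1 : y ≠ 1) (hc : Commute x y) : orderOf x = orderOf y := by
  have := h.orderOf_eq_of_commute (x := ⟨x, hx⟩) (y := ⟨y, hy⟩) (by simpa using hx1)
    (by simpa using hy1) (Subtype.ext hc)
  rwa [Subgroup.orderOf_mk, Subgroup.orderOf_mk] at this

theorem HasPrimeOrbits.orderOf_eq_of_mem_of_le (h : HasPrimeOrbits S) {p : ℕ} (hp : p.Prime)
    {P : Subgroup G} (hP : IsPGroup p P) (hPS : P ≤ S) {x : G} (hxP : x ∈ P) (hx1 : x ≠ 1) :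
    orderOf x = p := by
  have : Fact p.Prime := ⟨hp⟩
  obtain ⟨k, hk⟩ := IsPGroup.iff_orderOf.1 hP ⟨x, hxP⟩
  rw [Subgroup.orderOf_mk] at hk
  have hx := h.prime_orderOf_of_mem (hPS hxP) hx1
  exact (Nat.prime_dvd_prime_iff_eq hx hp).1 (hx.dvd_of_dvd_pow hk.dvd)

variable [Finite G] [S.Normal]

theorem HasPrimeOrbits.false_of_orderOf_eq_two_pow (h : HasPrimeOrbits S) {g₀ : G} (hg₀ : g₀ ∉ S)
    {a : ℕ} (hout : ∀ x ∉ S, orderOf x = 2 ^ a ∧ x ^ 2 ∈ S) : False := by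
  have hp2 : Nat.Prime 2 := Nat.prime_two
  have : Fact (Nat.Prime 2) := ⟨hp2⟩
  let T : Sylow 2 S := default
  obtain ⟨g₁, hg₁, hg₁K⟩ := T.exists_mem_normalizer_notMem hg₀
  set T' := (T : Subgroup S).map S.subtype
  have hT' : IsPGroup 2 T' := T.isPGroup'.map _
  have hT'S : T' ≤ S := Subgroup.map_subtype_le _
  have hcommT : ∀ x ∈ T, ∀ y ∈ T, Commute x y := fun x hx y hy ↦ by
    have hsq : ∀ z ∈ T, z⁻¹ = z := fun z hz ↦ by
      rcases eq_or_ne z 1 with rfl | hz1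
      · exact inv_one
      · refine inv_eq_of_mul_eq_one_left ?_
        rw [← sq, ← h.orderOf_eq_of_mem T.isPGroup' hz hz1, pow_orderOf_eq_one]
    have h1 := hsq _ (mul_mem hx hy)
    rw [mul_inv_rev, hsq x hx, hsq y hy] at h1
    exact h1.symm
  have hTn := nontrivial_sylow h.two_dvd_card T
  obtain ⟨r, hr, hrd⟩ := Nat.exists_prime_and_dvd
    (h.relIndex_normalizer_ne_one T ((Subgroup.nontrivial_iff_ne_bot _).1 hTn) hcommT)
  have hr2 : r ≠ 2 := by
    rintro rfl
    exact not_dvd_relIndex_normalizer T hrd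
  have : Fact r.Prime := ⟨hr⟩
  obtain ⟨x, hx⟩ := exists_prime_orderOf_dvd_card' r (hrd.trans (Subgroup.relIndex_dvd_card _ _))
  rw [← Subgroup.orderOf_coe, ← Subgroup.orderOf_coe] at hx
  have hmapN : ∀ y : S, (y : G) ∈ Subgroup.normalizer (T' : Set G) ↔
      y ∈ Subgroup.normalizer (T : Set S) := fun y ↦ by
    have hmem : ∀ z : S, (z : G) ∈ T' ↔ z ∈ T := fun z ↦
      Subgroup.mem_map_iff_mem S.subtype_injective
    constructor
    · intro hy
      refine Subgroup.mem_normalizer_iff.2 fun z ↦ ?_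
      have := Subgroup.mem_normalizer_iff.1 hy z
      exact (hmem z).symm.trans (this.trans (hmem (y * z * y⁻¹)))
    · intro hy
      have hy' := Subgroup.mem_normalizer_iff.1 hy
      refine Subgroup.mem_normalizer_iff.2 fun z ↦ ?_
      by_cases hz : z ∈ S
      · exact (hmem ⟨z, hz⟩).trans ((hy' ⟨z, hz⟩).trans (hmem (y * ⟨z, hz⟩ * y⁻¹)).symm)
      · refine iff_of_false (fun hz' ↦ hz (hT'S hz')) fun hz' ↦ hz ?_
        simpa [mul_assoc] using Subgroup.Normal.conj_mem inferInstance _ (hT'S hz') (y : G)⁻¹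
  obtain ⟨R, hRle, hR, hRbot, g, hgK, hgS, hgR⟩ := exists_isPGroup_normalized hg₁K hg₁
    ((hmapN x).2 x.2) (x : S).2 hx
  obtain ⟨k, hkR, hk1⟩ := (Subgroup.bot_or_exists_ne_one R).resolve_left hRbot
  have hkS := (hRle hkR).2
  by_cases hg2 : g ^ 2 = 1
  · have ha : ∀ y ∉ S, y ^ 2 = 1 := fun y hy ↦ orderOf_dvd_iff_pow_eq_one.1
      ((hout y hy).1.trans (hout g hgS).1.symm ▸ orderOf_dvd_of_pow_eq_one hg2)
    refine h.not_isMulCommutative fun x y ↦ Subtype.ext ?_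
    refine commute_of_forall_conj_eq_inv (S := S) (g := g) (fun s hs ↦ ?_) x.2 y.2
    have h1 : g⁻¹ = g := inv_eq_of_mul_eq_one_left (by rw [← sq, hg2])
    have h2 := ha (g * s) fun hgs ↦ hgS ((Subgroup.mul_mem_cancel_right _ hs).1 hgs)
    rw [h1, eq_inv_iff_mul_eq_one, ← h2, sq, mul_assoc (g * s)]
  · have huS := (hout g hgS).2
    have hu2 : orderOf (g ^ 2) = 2 := by
      have hd : orderOf (g ^ 2) ∣ 2 ^ a := (hout g hgS).1 ▸ orderOf_pow_dvd 2
      have hpr := h.prime_orderOf_of_mem huS hg2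
      exact (Nat.prime_dvd_prime_iff_eq hpr hp2).1 (hpr.dvd_of_dvd_pow hd)
    have huT : g ^ 2 ∈ T' := by
      have hz : IsPGroup 2 (Subgroup.zpowers (⟨g ^ 2, huS⟩ : S)) := by
        refine IsPGroup.of_card (n := 1) ?_
        rw [Nat.card_zpowers, Subgroup.orderOf_mk, hu2, pow_one]
      have hinf := hz.inf_normalizer_sylow T
      have : (⟨g ^ 2, huS⟩ : S) ∈ Subgroup.zpowers (⟨g ^ 2, huS⟩ : S) ⊓
          Subgroup.normalizer (T : Set S) :=
        ⟨Subgroup.mem_zpowers _, (hmapN _).1 (pow_mem hgK 2)⟩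
      rw [hinf] at this
      exact Subgroup.mem_map_of_mem S.subtype this.2
    have hc : g ^ 2 * k * (g ^ 2)⁻¹ * k⁻¹ = 1 := by
      by_contra hne
      have hT : g ^ 2 * k * (g ^ 2)⁻¹ * k⁻¹ ∈ T' := by
        have := (Subgroup.mem_normalizer_iff.1 (hRle hkR).1 (g ^ 2)⁻¹).1 (inv_mem huT)
        simpa only [mul_assoc] using mul_mem huT this
      have hR' : g ^ 2 * k * (g ^ 2)⁻¹ * k⁻¹ ∈ R := by
        have := mul_mem (hgR _ (hgR k hkR)) (inv_mem hkR)
        simpa only [sq, mul_inv_rev, mul_assoc] using this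
      exact hr2 ((h.orderOf_eq_of_mem_of_le hr hR (hRle.trans inf_le_right) hR' hne).symm.trans
        (h.orderOf_eq_of_mem_of_le hp2 hT' hT'S hT hne))
    have hcomm : Commute (g ^ 2) k := by
      rwa [mul_inv_eq_one, mul_inv_eq_iff_eq_mul] at hc
    refine hr2 ?_
    rw [← h.orderOf_eq_of_mem_of_le hr hR (hRle.trans inf_le_right) hkR hk1, ← hu2]
    exact (h.orderOf_eq_of_commute_of_mem huS hkS hg2 hk1 hcomm).symm

theorem HasPrimeOrbits.false_of_orderOf_eq_odd_prime_pow (h : HasPrimeOrbits S) {g₀ : G}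
    (hg₀ : g₀ ∉ S) {l a : ℕ} (hl : l.Prime) (hl2 : l ≠ 2) (hout : ∀ x ∉ S, orderOf x = l ^ a) :
    False := by
  have hp2 : Nat.Prime 2 := Nat.prime_two
  have : Fact (Nat.Prime 2) := ⟨hp2⟩
  obtain ⟨t, x, ht, hm, hm2, htx⟩ := h.exists_involution_inverting
  have : Fact (orderOf x).Prime := ⟨hm⟩
  obtain ⟨X, hX⟩ := h.exists_sylow_eq_centralizer (p := orderOf x) (x := x) rfl
  obtain ⟨g₁, hg₁, hg₁K⟩ := X.exists_mem_normalizer_notMem hg₀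
  have hmemX : ∀ y : G, y ∈ (X : Subgroup S).map S.subtype ↔ y ∈ S ∧ Commute (x : G) y :=
    fun y ↦ by
      rw [hX]
      constructor
      · rintro ⟨y, hy, rfl⟩
        exact ⟨y.2, congrArg Subtype.val (Subgroup.mem_centralizer_singleton_iff.1 hy).symm⟩
      · rintro ⟨hyS, hy⟩
        exact ⟨⟨y, hyS⟩, Subgroup.mem_centralizer_singleton_iff.2 (Subtype.ext hy.symm), rfl⟩
  set X' := (X : Subgroup S).map S.subtype
  have hX' : IsPGroup (orderOf x) X' := X.isPGroup'.map _
  have hX'S : X' ≤ S := Subgroup.map_subtype_le _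
  have hxX : (x : G) ∈ X' := (hmemX x).2 ⟨x.2, Commute.refl _⟩
  have hx1 : (x : G) ≠ 1 := fun h1 ↦ hm.ne_one (by rw [← Subgroup.orderOf_coe, h1, orderOf_one])
  have htx' : (t : G) * x * (t : G)⁻¹ = (x : G)⁻¹ := congrArg Subtype.val htx
  have htK : (t : G) ∈ Subgroup.normalizer (X' : Set G) := by
    refine Subgroup.mem_normalizer_iff.2 fun y ↦ ?_
    have h1 : Commute ((t : G) * x * (t : G)⁻¹) (t * y * (t : G)⁻¹) ↔ Commute (x : G) y :=
      ⟨fun hc ↦ by simpa [mul_assoc] using hc.map (MulAut.conj (t : G)⁻¹),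
        fun hc ↦ hc.map (MulAut.conj (t : G))⟩
    rw [hmemX, hmemX, ← h1, htx', Commute.inv_left_iff]
    refine and_congr_left fun _ ↦ ⟨fun hy ↦ Subgroup.Normal.conj_mem inferInstance _ hy t,
      fun hy ↦ ?_⟩
    simpa [mul_assoc] using Subgroup.Normal.conj_mem inferInstance _ hy (t : G)⁻¹
  obtain ⟨R, hRle, hR, hRbot, g, hgK, hgS, hgR⟩ := exists_isPGroup_normalized (p := 2) hg₁K hg₁
    htK t.2 (by rwa [Subgroup.orderOf_coe])
  have hR2 : ∀ b ∈ R, b ≠ 1 → orderOf b = 2 := fun b hb hb1 ↦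
    h.orderOf_eq_of_mem_of_le hp2 hR (hRle.trans inf_le_right) hb hb1
  have hfix : ∀ b ∈ R, b ≠ 1 → ∀ y ∈ X', Commute b y → y = 1 := fun b hb hb1 y hy hc ↦ by
    by_contra hy1
    refine hm2 ((hR2 b hb hb1).symm.trans ?_).symm
    rw [h.orderOf_eq_of_commute_of_mem (hRle hb).2 (hX'S hy) hb1 hy1 hc]
    exact h.orderOf_eq_of_mem_of_le hm hX' hX'S hy hy1
  -- each involution of `R` acts on `X'` without fixed points, hence inverts it
  have hinv : ∀ b ∈ R, b ≠ 1 → b * x * b⁻¹ = (x : G)⁻¹ := fun b hb hb1 ↦ by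
    have hbK := Subgroup.mem_normalizer_iff.1 (hRle hb).1
    have hinj : Function.Injective fun y : X' ↦ (⟨(y : G)⁻¹ * (b * y * b⁻¹),
        mul_mem (inv_mem y.2) ((hbK y).1 y.2)⟩ : X') := by
      intro y z hyz
      have h1 : (y : G)⁻¹ * (b * y * b⁻¹) = (z : G)⁻¹ * (b * z * b⁻¹) := congrArg Subtype.val hyz
      have h2 : (y : G) * (z : G)⁻¹ = 1 := hfix b hb hb1 _ (mul_mem y.2 (inv_mem z.2)) <| by
        change b * ((y : G) * (z : G)⁻¹) = y * (z : G)⁻¹ * b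
        have h3 := congrArg (fun g ↦ (y : G) * g * b * (z : G)⁻¹) h1
        simp only [mul_assoc, mul_inv_cancel_left, inv_mul_cancel_left, mul_inv_cancel,
          mul_one] at h3 ⊢
        exact h3
      exact Subtype.ext (mul_inv_eq_one.1 h2)
    obtain ⟨y, hy⟩ := Finite.surjective_of_injective hinj ⟨x, hxX⟩
    have hy' : (y : G)⁻¹ * (b * y * b⁻¹) = x := congrArg Subtype.val hy
    have hb2 : b⁻¹ = b := inv_eq_of_mul_eq_one_left
      (by rw [← sq, ← hR2 b hb hb1, pow_orderOf_eq_one])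
    calc b * x * b⁻¹ = b * (y : G)⁻¹ * b * y * (b⁻¹ * b⁻¹) := by rw [← hy']; group
      _ = b * (y : G)⁻¹ * b * y * (b⁻¹ * b) := by rw [hb2]
      _ = b * (y : G)⁻¹ * b⁻¹ * y := by rw [inv_mul_cancel, mul_one, hb2]
      _ = (x : G)⁻¹ := by rw [← hy']; group
  obtain ⟨b, hbR, hb1⟩ := (Subgroup.bot_or_exists_ne_one R).resolve_left hRbot
  have huniq : ∀ c ∈ R, c ≠ 1 → c = b := fun c hc hc1 ↦ by
    have h1 : Commute (b * c) (x : G) := by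
      have h2 : b * c * x * (b * c)⁻¹ = x := by
        calc b * c * x * (b * c)⁻¹ = b * (c * x * c⁻¹) * b⁻¹ := by group
          _ = (b * x * b⁻¹)⁻¹ := by rw [hinv c hc hc1]; group
          _ = x := by rw [hinv b hbR hb1, inv_inv]
      rwa [mul_inv_eq_iff_eq_mul] at h2
    have h2 : b * c = 1 := by_contra fun hne ↦ hx1 (hfix _ (mul_mem hbR hc) hne x hxX h1)
    rw [← inv_eq_of_mul_eq_one_left h2]
    exact (inv_eq_of_mul_eq_one_left (by rw [← sq, ← hR2 c hc hc1, pow_orderOf_eq_one])).symm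
  have hgb : Commute g b := by
    have h1 := huniq _ (hgR b hbR) (by simpa using hb1)
    rwa [mul_inv_eq_iff_eq_mul] at h1
  have hcop : (orderOf g).Coprime (orderOf b) := by
    rw [hout g hgS, hR2 b hbR hb1]
    exact Nat.Coprime.pow_left a ((Nat.coprime_primes hl hp2).2 hl2)
  have h1 := hgb.orderOf_mul_eq_mul_orderOf_of_coprime hcop
  rw [hout _ fun hgb' ↦ hgS ((Subgroup.mul_mem_cancel_right _ (hRle hbR).2).1 hgb'),
    hout g hgS, hR2 b hbR hb1] at h1
  have := Nat.pow_pos (n := a) hl.pos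
  omega

end

theorem six_le_omegaAut_of_subgroup {G : Type*} [Group G] [Finite G] {S : Subgroup G}
    (hS : S.Characteristic) (htop : S ≠ ⊤) (hs : ¬ Group.IsSolvable S) : 6 ≤ omegaAut G := by
  classical
  by_contra! hlt
  let c : G → ℕ := fun x ↦ if x ∈ S then orderOf x else 0
  have hcS : ∀ x ∈ S, c x = orderOf x := fun x hx ↦ if_pos hx
  have hcS' : ∀ x ∉ S, c x = 0 := fun x hx ↦ if_neg hx
  obtain ⟨g₀, -, hg₀⟩ := SetLike.exists_of_lt (lt_top_iff_ne_top.2 htop)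
  set T := (Nat.card S).primeFactors
  have h1T : 1 ∉ T := fun h1 ↦ (Nat.prime_of_mem_primeFactors h1).ne_one rfl
  have h0T : 0 ∉ insert 1 T := fun h0 ↦ by
    rcases Finset.mem_insert.1 h0 with h0 | h0
    · exact zero_ne_one h0
    · exact (Nat.prime_of_mem_primeFactors h0).ne_zero rfl
  have hcard : (insert 0 (insert 1 T)).card = T.card + 2 := by
    rw [Finset.card_insert_of_notMem h0T, Finset.card_insert_of_notMem h1T]
  have hT : 3 ≤ T.card := three_le_card_primeFactors hs
  obtain ⟨hle, hsep⟩ := card_le_omegaAut c (fun α x ↦ by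
      simp only [c, hS.apply_mem_iff, MulEquiv.orderOf_eq]) (insert 0 (insert 1 T))
    fun n hn ↦ by
      rcases Finset.mem_insert.1 hn with rfl | hn
      · exact ⟨g₀, if_neg hg₀⟩
      rcases Finset.mem_insert.1 hn with rfl | hn
      · exact ⟨1, (hcS 1 (one_mem S)).trans orderOf_one⟩
      · obtain ⟨x, hx⟩ := exists_orderOf_eq_of_mem_primeFactors hn
        exact ⟨x, (hcS x x.2).trans (by rwa [Subgroup.orderOf_coe])⟩
  obtain ⟨hmem, hsep⟩ := hsep (by omega)
  have h : HasPrimeOrbits S :=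
    { not_isSolvable := hs
      prime_orderOf := fun x hx ↦ by
        have h1 := hmem x
        have h2 : orderOf x ≠ 1 := fun h ↦ hx (orderOf_eq_one_iff.1 h)
        have h3 : orderOf x ≠ 0 := (orderOf_pos _).ne'
        rw [hcS x x.2, Subgroup.orderOf_coe, Finset.mem_insert, Finset.mem_insert] at h1
        exact Nat.prime_of_mem_primeFactors ((h1.resolve_left h3).resolve_left h2)
      exists_mulAut := fun x y hxy ↦ by
        obtain ⟨α, hα⟩ := hsep x y (by
          rw [hcS x x.2, hcS y y.2, Subgroup.orderOf_coe, Subgroup.orderOf_coe, hxy])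
        exact ⟨MulAut.characteristic S α, Subtype.ext hα⟩
      card_primeFactors_le := show T.card ≤ 3 by omega }
  obtain ⟨l, a, hl, hout⟩ := exists_orderOf_eq_prime_pow hg₀ fun x y hx hy ↦ by
    obtain ⟨α, rfl⟩ := hsep x y ((hcS' x hx).trans (hcS' y hy).symm)
    rw [MulEquiv.orderOf_eq]
  rcases eq_or_ne l 2 with rfl | hl2
  · exact h.false_of_orderOf_eq_two_pow hg₀ hout
  · exact h.false_of_orderOf_eq_odd_prime_pow hg₀ hl hl2 fun x hx ↦ (hout x hx).1

/-- Every finite nonsolvable group that is not simple has at least 6 automorphism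
orbits. -/
theorem stmt_11 (G : Type*) [Group G] [Finite G] (hns : ¬ IsSolvable G)
    (hnotsimple : ¬ IsSimpleGroup G) :
    6 ≤ omegaAut G := by
  by_cases hchar : ∀ N : Subgroup G, N.Characteristic → N = ⊥ ∨ N = ⊤
  · exact six_le_omegaAut_of_characteristic hns hnotsimple hchar
  push Not at hchar
  obtain ⟨N, hN, hbot, htop⟩ := hchar
  rcases not_and_or.1 (mt (Group.isSolvable_iff_subgroup_quotient N).2 hns) with h | h
  · exact six_le_omegaAut_of_subgroup hN htop h
  · exact six_le_omegaAut_of_quotient hN hbot h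
end

section
/- The set of orders of elements of PSL(2,8) is exactly {1, 2, 3, 7, 9}. -/
open scoped MatrixGroups

open Matrix

section CharTwo

variable {F : Type*} [Field F]

theorem Matrix.pow_succ_eq_of_pow_eq {M : Matrix (Fin 2) (Fin 2) F} {t : F}
    (hM : M * M = t • M + 1) {n : ℕ} {u v : F} (h : M ^ n = u • M + v • 1) :
    M ^ (n + 1) = (t * u + v) • M + u • 1 := by
  rw [pow_succ, h, add_mul, smul_mul_assoc, hM, smul_mul_assoc, one_mul]
  module

theorem Matrix.pow_three_eq {M : Matrix (Fin 2) (Fin 2) F} {t : F}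
    (hM : M * M = t • M + 1) : M ^ 3 = (t ^ 2 + 1) • M + t • 1 := by
  have h2 : M ^ 2 = t • M + (1 : F) • 1 := by rw [pow_two, hM, one_smul]
  rw [pow_succ_eq_of_pow_eq hM h2, pow_two]

variable [CharP F 2]

theorem Matrix.mul_self_eq_trace_smul_add_one (A : SL(2, F)) :
    A.1 * A.1 = A.1.trace • A.1 + 1 := by
  have h2 : (2 : F) = 0 := CharP.cast_eq_zero F 2
  have hdet := A.det_coe
  rw [det_fin_two] at hdet
  ext i j
  fin_cases i <;> fin_cases j <;>
    simp [mul_apply, trace_fin_two, Fin.sum_univ_two]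
  · linear_combination (-1 : F) * hdet - h2
  · ring
  · ring
  · linear_combination (-1 : F) * hdet - h2

theorem Matrix.pow_seven_eq {M : Matrix (Fin 2) (Fin 2) F} {t : F}
    (hM : M * M = t • M + 1) : M ^ 7 = (t ^ 6 + t ^ 4 + 1) • M + (t ^ 5 + t) • 1 := by
  have h2 : (2 : F) = 0 := CharP.cast_eq_zero F 2
  rw [pow_succ_eq_of_pow_eq hM <| pow_succ_eq_of_pow_eq hM <| pow_succ_eq_of_pow_eq hM <|
    pow_succ_eq_of_pow_eq hM <| pow_three_eq hM]
  congr 2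
  · linear_combination (2 * t ^ 4 + 3 * t ^ 2) * h2
  · linear_combination (2 * t ^ 3 + t) * h2

theorem Matrix.pow_nine_eq {M : Matrix (Fin 2) (Fin 2) F} {t : F}
    (hM : M * M = t • M + 1) :
    M ^ 9 = (t ^ 8 + t ^ 6 + t ^ 4 + 1) • M + t ^ 7 • 1 := by
  have h2 : (2 : F) = 0 := CharP.cast_eq_zero F 2
  rw [pow_succ_eq_of_pow_eq hM <| pow_succ_eq_of_pow_eq hM <| pow_seven_eq hM]
  congr 2
  · linear_combination (t ^ 6 + t ^ 2) * h2
  · linear_combination (t ^ 5 + t) * h2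

namespace Matrix.SpecialLinearGroup

theorem pow_two_eq_one_of_trace {A : SL(2, F)} (h : A.1.trace = 0) : A ^ 2 = 1 := by
  apply Subtype.ext
  rw [coe_pow, pow_two, mul_self_eq_trace_smul_add_one, h, zero_smul, zero_add, coe_one]

theorem pow_three_eq_one_of_trace {A : SL(2, F)} (h : A.1.trace = 1) : A ^ 3 = 1 := by
  apply Subtype.ext
  rw [coe_pow, pow_three_eq (mul_self_eq_trace_smul_add_one A), h, one_pow,
    CharTwo.add_self_eq_zero, zero_smul, zero_add, one_smul, coe_one]

theorem pow_seven_eq_one_of_trace {A : SL(2, F)}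
    (h : A.1.trace ^ 3 + A.1.trace ^ 2 + 1 = 0) : A ^ 7 = 1 := by
  have h2 : (2 : F) = 0 := CharP.cast_eq_zero F 2
  apply Subtype.ext
  rw [coe_pow, pow_seven_eq (mul_self_eq_trace_smul_add_one A), coe_one]
  set t := A.1.trace
  have hu : t ^ 6 + t ^ 4 + 1 = 0 := by
    linear_combination (t ^ 3 + t ^ 2 + 1) * h - (t ^ 5 + t ^ 3 + t ^ 2) * h2
  have hv : t ^ 5 + t = 1 := by
    linear_combination (t ^ 2 + t + 1) * h - (t ^ 4 + t ^ 3 + t ^ 2 + 1) * h2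
  rw [hu, hv, zero_smul, zero_add, one_smul]

theorem pow_nine_eq_one_of_trace {A : SL(2, F)}
    (h : A.1.trace ^ 3 + A.1.trace + 1 = 0) : A ^ 9 = 1 := by
  have h2 : (2 : F) = 0 := CharP.cast_eq_zero F 2
  apply Subtype.ext
  rw [coe_pow, pow_nine_eq (mul_self_eq_trace_smul_add_one A), coe_one]
  set t := A.1.trace
  have h3 : t ^ 3 = t + 1 := by linear_combination h - (t + 1) * h2
  have hv : t ^ 7 = 1 := by
    linear_combination (t ^ 4 + t ^ 2 + t + 1) * h3 + (t ^ 2 + t) * h2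
  have hu : t ^ 8 + t ^ 6 + t ^ 4 + 1 = 0 := by
    linear_combination t * hv + (t ^ 3 + 2 * t + 1) * h3 + (t ^ 2 + 2 * t + 1) * h2
  rw [hu, hv, zero_smul, zero_add, one_smul]

variable (F) in
theorem center_fin_two_eq_bot : Subgroup.center SL(2, F) = ⊥ := by
  refine (Subgroup.eq_bot_iff_forall _).2 fun A hA ↦ ?_
  obtain ⟨r, hr, hA⟩ := mem_center_iff.1 hA
  have hr1 : r = 1 := by
    rw [Fintype.card_fin, ← sub_eq_zero, ← one_pow 2, ← sub_pow_char] at hr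
    exact sub_eq_zero.1 (pow_eq_zero_iff two_ne_zero |>.1 hr)
  apply Subtype.ext
  rw [← hA, hr1, map_one, coe_one]

variable (F) in
theorem range_orderOf_psl_two :
    Set.range (orderOf : PSL(2, F) → ℕ) = Set.range (orderOf : SL(2, F) → ℕ) := by
  have hinj : Function.Injective (QuotientGroup.mk' (Subgroup.center SL(2, F))) := by
    rw [← MonoidHom.ker_eq_bot_iff, QuotientGroup.ker_mk', center_fin_two_eq_bot]
  have hcomp : (orderOf : SL(2, F) → ℕ) =
      orderOf ∘ QuotientGroup.mk' (Subgroup.center SL(2, F)) :=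
    funext fun A ↦ (orderOf_injective _ hinj A).symm
  rw [hcomp, (QuotientGroup.mk'_surjective _).range_comp]

/-- A matrix of determinant one with prescribed trace, in characteristic two. -/
def ofTrace (t : F) : SL(2, F) :=
  ⟨!![t, 1; 1, 0], by simp [det_fin_two, CharTwo.neg_eq]⟩

theorem trace_ofTrace (t : F) : (ofTrace t).1.trace = t := by
  simp [ofTrace, trace_fin_two]

theorem ofTrace_ne_one (t : F) : ofTrace t ≠ 1 := fun h ↦ by
  have h01 := congrArg (fun A : SL(2, F) ↦ A.1 0 1) h
  simp [ofTrace] at h01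

theorem ofTrace_pow_three_ne_one {t : F} (ht : t ≠ 1) : ofTrace t ^ 3 ≠ 1 := fun h ↦ by
  have h01 := congrArg (fun A : SL(2, F) ↦ A.1 0 1) h
  simp only [coe_pow, pow_three_eq (mul_self_eq_trace_smul_add_one (ofTrace t)),
    trace_ofTrace] at h01
  have ht2 : t ^ 2 + 1 = 0 := by simpa [ofTrace] using h01
  refine ht (CharTwo.add_eq_zero.1 (pow_eq_zero_iff two_ne_zero |>.1 ?_))
  rw [CharTwo.add_sq, one_pow, ht2]

end Matrix.SpecialLinearGroup

theorem eq_or_cubic_of_pow_eight_eq_self {t : F} (ht : t ^ 8 = t) :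
    t = 0 ∨ t = 1 ∨ t ^ 3 + t ^ 2 + 1 = 0 ∨ t ^ 3 + t + 1 = 0 := by
  have h2 : (2 : F) = 0 := CharP.cast_eq_zero F 2
  have h : t * ((t - 1) * ((t ^ 3 + t ^ 2 + 1) * (t ^ 3 + t + 1))) = 0 := by
    linear_combination ht + (t ^ 5 - t ^ 4) * h2
  simpa [sub_eq_zero] using h

theorem Matrix.SpecialLinearGroup.range_orderOf_fin_two_of_card_eq_eight (hF : Nat.card F = 8) :
    Set.range (orderOf : SL(2, F) → ℕ) = {1, 2, 3, 7, 9} := by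
  have : Finite F := Nat.finite_of_card_ne_zero (by omega)
  have : Fintype F := Fintype.ofFinite F
  have hcard : Fintype.card F = 8 := by rw [← Nat.card_eq_fintype_card, hF]
  have hpow (t : F) : t ^ 8 = t := by rw [← hcard, FiniteField.pow_card]
  apply Set.Subset.antisymm
  · rintro _ ⟨A, rfl⟩
    rcases eq_or_cubic_of_pow_eight_eq_self (hpow A.1.trace) with h | h | h | h
    · have := (Nat.dvd_prime Nat.prime_two).1 (orderOf_dvd_of_pow_eq_one (pow_two_eq_one_of_trace h))
      grind
    · have := (Nat.dvd_prime Nat.prime_three).1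
        (orderOf_dvd_of_pow_eq_one (pow_three_eq_one_of_trace h))
      grind
    · have := (Nat.dvd_prime (by norm_num)).1
        (orderOf_dvd_of_pow_eq_one (pow_seven_eq_one_of_trace h))
      grind
    · obtain ⟨k, hk, h⟩ := (Nat.dvd_prime_pow Nat.prime_three (m := 2)).1
        (orderOf_dvd_of_pow_eq_one (pow_nine_eq_one_of_trace h))
      interval_cases k <;> simp [h]
  · obtain ⟨s, hs⟩ : ∃ s : F, s ^ 3 + s ^ 2 + 1 = 0 := by
      classical
      obtain ⟨t, -, ht⟩ := Finset.exists_mem_notMem_of_card_lt_card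
        (s := {0, 1}) (t := (Finset.univ : Finset F))
        (by rw [Finset.card_univ, hcard]; exact Finset.card_le_two.trans_lt (by norm_num))
      simp only [Finset.mem_insert, Finset.mem_singleton, not_or] at ht
      rcases eq_or_cubic_of_pow_eight_eq_self (hpow t) with h | h | h | h
      · exact absurd h ht.1
      · exact absurd h ht.2
      · exact ⟨t, h⟩
      · have h2 : (2 : F) = 0 := CharP.cast_eq_zero F 2
        exact ⟨t + 1, by linear_combination h + (2 * t ^ 2 + 2 * t + 1) * h2⟩
    have hs' : (s + 1) ^ 3 + (s + 1) + 1 = 0 := by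
      have h2 : (2 : F) = 0 := CharP.cast_eq_zero F 2
      linear_combination hs + (s ^ 2 + 2 * s + 1) * h2
    have hs0 : s + 1 ≠ 1 := fun h ↦ by
      rw [add_eq_right] at h
      simp [h] at hs
    rintro n (rfl | rfl | rfl | rfl | rfl)
    · exact ⟨1, orderOf_one⟩
    · exact ⟨ofTrace 0, orderOf_eq_prime (pow_two_eq_one_of_trace (trace_ofTrace 0))
        (ofTrace_ne_one 0)⟩
    · exact ⟨ofTrace 1, orderOf_eq_prime (pow_three_eq_one_of_trace (trace_ofTrace 1))
        (ofTrace_ne_one 1)⟩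
    · have : Fact (Nat.Prime 7) := ⟨by norm_num⟩
      exact ⟨ofTrace s, orderOf_eq_prime (pow_seven_eq_one_of_trace (by rwa [trace_ofTrace]))
        (ofTrace_ne_one s)⟩
    · exact ⟨ofTrace (s + 1), orderOf_eq_prime_pow (p := 3) (n := 1)
        (by simpa using ofTrace_pow_three_ne_one hs0)
        (pow_nine_eq_one_of_trace (by rwa [trace_ofTrace]))⟩

end CharTwo

/-- The spectrum (set of element orders) of `PSL(2,8)` is `{1, 2, 3, 7, 9}`. -/
theorem stmt_14 :
    Set.range (orderOf : PSL(2, GaloisField 2 3) → ℕ) = {1, 2, 3, 7, 9} := by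
  rw [Matrix.SpecialLinearGroup.range_orderOf_psl_two]
  exact Matrix.SpecialLinearGroup.range_orderOf_fin_two_of_card_eq_eight
    (GaloisField.card 2 3 three_ne_zero)
end

section
/- The set of orders of elements of PSL(3,4) is exactly {1, 2, 3, 4, 5, 7}. -/
open scoped MatrixGroups

namespace PSLThreeFour

open Polynomial Matrix

section Cubic

variable {F : Type*} [Field F]

/-- The monic cubic `X ^ 3 + t X ^ 2 + s X + 1`. -/
noncomputable def cubic (t s : F) : F[X] := X ^ 3 + C t * X ^ 2 + C s * X + 1

theorem exists_charpoly_eq_cubic [CharP F 2] (A : SL(3, F)) :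
    ∃ t s : F, A.1.charpoly = cubic t s := by
  have hdet := A.2
  have two : (2 : F[X]) = 0 := CharTwo.two_eq_zero
  rw [det_fin_three] at hdet
  have hC := congrArg (C : F → F[X]) hdet
  refine ⟨A.1 0 0 + A.1 1 1 + A.1 2 2,
    A.1 0 0 * A.1 1 1 - A.1 0 1 * A.1 1 0 + A.1 0 0 * A.1 2 2 - A.1 0 2 * A.1 2 0
      + A.1 1 1 * A.1 2 2 - A.1 1 2 * A.1 2 1, ?_⟩
  simp only [C_add, C_sub, C_mul, C_1] at hC
  simp only [charpoly, det_fin_three, charmatrix_apply, cubic, diagonal_apply, C_add, C_sub, C_mul]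
  simp
  linear_combination -hC
    - (C (A.1 0 0) * X ^ 2 + C (A.1 1 1) * X ^ 2 + C (A.1 2 2) * X ^ 2 + 1) * two

theorem pow_eq_scalar_of_cubic_dvd {t s c : F} {n : ℕ} {A : Matrix (Fin 3) (Fin 3) F}
    (hA : aeval A (cubic t s) = 0) (h : cubic t s ∣ X ^ n - C c) :
    A ^ n = scalar (Fin 3) c := by
  obtain ⟨q, hq⟩ := h
  have := congrArg (aeval A) hq
  rw [map_mul, hA, zero_mul] at this
  simpa [sub_eq_zero, algebraMap_eq_diagonal, Pi.algebraMap_def] using this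

variable [CharP F 2]

theorem cubic_dvd_pow_three : cubic (0 : F) 0 ∣ X ^ 3 - C 1 := by
  have two : (2 : F[X]) = 0 := CharTwo.two_eq_zero
  refine ⟨1, ?_⟩
  simp only [cubic, C_0, C_1]
  linear_combination -two

theorem cubic_dvd_pow_four {t : F} (ht : t ^ 3 = 1) : cubic t (t ^ 2) ∣ X ^ 4 - C t := by
  have two : (2 : F[X]) = 0 := CharTwo.two_eq_zero
  have ht' : (C t : F[X]) ^ 3 = 1 := by rw [← C_pow, ht, C_1]
  refine ⟨X + C t, ?_⟩
  simp only [cubic, C_pow]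
  linear_combination X * ht'
    - (C t * X ^ 3 + C t ^ 2 * X ^ 2 + C t ^ 3 * X + C t) * two

theorem cubic_dvd_pow_five {t s : F} (ht : t ^ 3 = 1) (hs : s ^ 2 + t ^ 2 * s + t = 0) :
    cubic t s ∣ X ^ 5 - C (t ^ 2 + s) := by
  have two : (2 : F[X]) = 0 := CharTwo.two_eq_zero
  have ht' : (C t : F[X]) ^ 3 = 1 := by rw [← C_pow, ht, C_1]
  have hs' : (C s : F[X]) ^ 2 + C t ^ 2 * C s + C t = 0 := by
    simpa using congrArg (C : F → F[X]) hs
  refine ⟨X ^ 2 + C t * X + (C t ^ 2 + C s), ?_⟩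
  simp only [cubic, C_pow, C_add]
  linear_combination - X ^ 2 * ht' - X * hs'
    - (X ^ 4 * C t + X ^ 3 * C t ^ 2 + X ^ 3 * C s + X ^ 2 * C t * C s + X ^ 2 + C t ^ 2 + C s) * two

theorem cubic_dvd_pow_seven_of_zero_left {s : F} (hs : s ^ 3 = 1) :
    cubic 0 s ∣ X ^ 7 - C (s ^ 2) := by
  have two : (2 : F[X]) = 0 := CharTwo.two_eq_zero
  have hs' : (C s : F[X]) ^ 3 = 1 := by rw [← C_pow, hs, C_1]
  refine ⟨X ^ 4 + C s * X ^ 2 + X + C s ^ 2, ?_⟩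
  simp only [cubic, C_pow, C_0]
  linear_combination - X * hs'
    - (X ^ 5 * C s + X ^ 4 + X ^ 3 * C s ^ 2 + X ^ 2 * C s + X + C s ^ 2) * two

theorem cubic_dvd_pow_seven_of_zero_right {t : F} (ht : t ^ 3 = 1) :
    cubic t 0 ∣ X ^ 7 - C t := by
  have two : (2 : F[X]) = 0 := CharTwo.two_eq_zero
  have ht' : (C t : F[X]) ^ 3 = 1 := by rw [← C_pow, ht, C_1]
  refine ⟨X ^ 4 + C t * X ^ 3 + C t ^ 2 * X ^ 2 + C t, ?_⟩
  simp only [cubic, C_0]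
  linear_combination - X ^ 4 * ht'
    - (X ^ 6 * C t + X ^ 5 * C t ^ 2 + X ^ 4 + X ^ 3 * C t + X ^ 2 * C t ^ 2 + C t) * two

/-- The companion matrix of `cubic t s`. -/
def companion (t s : F) : SL(3, F) :=
  ⟨!![0, 0, 1; 1, 0, s; 0, 1, t], by simp [det_fin_three]⟩

theorem aeval_companion (t s : F) : aeval (companion t s).1 (cubic t s) = 0 := by
  have two : (2 : F) = 0 := CharTwo.two_eq_zero
  ext i j
  fin_cases i <;> fin_cases j <;>
    simp [cubic, companion, pow_succ, mul_apply, algebraMap_matrix_apply] <;>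
    grind

end Cubic

section SpecialLinear

variable {F : Type*} [Field F]

theorem mem_center_of_pow_eq_scalar {c : F} {n : ℕ} {A : SL(3, F)}
    (h : A.1 ^ n = scalar (Fin 3) c) : A ^ n ∈ Subgroup.center SL(3, F) := by
  have hA : scalar (Fin 3) c = (A ^ n : SL(3, F)).1 :=
    h.symm.trans (Matrix.SpecialLinearGroup.coe_pow A n).symm
  refine Matrix.SpecialLinearGroup.mem_center_iff.mpr ⟨c, ?_, hA⟩
  have hdet := (A ^ n : SL(3, F)).2
  rw [← hA] at hdet
  simpa using hdet

theorem notMem_center_of_apply_ne_zero {A : SL(3, F)} {i j : Fin 3} (hij : i ≠ j)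
    (h : A.1 i j ≠ 0) : A ∉ Subgroup.center SL(3, F) := by
  intro hA
  obtain ⟨r, -, hr⟩ := Matrix.SpecialLinearGroup.mem_center_iff.mp hA
  apply h
  rw [← hr]
  simp [hij]

theorem mk_pow_eq_one_iff {A : SL(3, F)} {n : ℕ} :
    (A : PSL(3, F)) ^ n = 1 ↔ A ^ n ∈ Subgroup.center SL(3, F) := by
  rw [← QuotientGroup.mk_pow, QuotientGroup.eq_one_iff]

theorem mk_pow_eq_one_of_cubic_dvd {t s c : F} {n : ℕ} {A : SL(3, F)}
    (hA : aeval A.1 (cubic t s) = 0) (h : cubic t s ∣ X ^ n - C c) : (A : PSL(3, F)) ^ n = 1 :=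
  mk_pow_eq_one_iff.mpr (mem_center_of_pow_eq_scalar (pow_eq_scalar_of_cubic_dvd hA h))

theorem mk_companion_ne_one (t s : F) : (companion t s : PSL(3, F)) ≠ 1 := by
  rw [Ne, QuotientGroup.eq_one_iff]
  exact notMem_center_of_apply_ne_zero (i := 1) (j := 0) (by decide) (by simp [companion])

variable [CharP F 2]

theorem orderOf_mk_companion_of_prime {t s c : F} {p : ℕ} [Fact p.Prime]
    (h : cubic t s ∣ X ^ p - C c) : orderOf (companion t s : PSL(3, F)) = p :=
  orderOf_eq_prime (mk_pow_eq_one_of_cubic_dvd (aeval_companion t s) h) (mk_companion_ne_one t s)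

theorem orderOf_mk_companion_one_one : orderOf (companion (1 : F) 1 : PSL(3, F)) = 4 := by
  refine orderOf_eq_prime_pow (p := 2) (n := 1) ?_ ?_
  · rw [mk_pow_eq_one_iff, pow_one, pow_two]
    refine notMem_center_of_apply_ne_zero (i := 2) (j := 0) (by decide) ?_
    change ((companion (1 : F) 1).1 * (companion (1 : F) 1).1) 2 0 ≠ 0
    simp [companion, mul_apply, Fin.sum_univ_three]
  · have h := cubic_dvd_pow_four (one_pow 3 : (1 : F) ^ 3 = 1)
    rw [one_pow] at h
    exact mk_pow_eq_one_of_cubic_dvd (aeval_companion 1 1) h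

theorem exists_orderOf_eq_two : ∃ x : PSL(3, F), orderOf x = 2 := by
  have two : (1 : F) + 1 = 0 := CharTwo.add_self_eq_zero 1
  let T : SL(3, F) := ⟨!![1, 1, 0; 0, 1, 0; 0, 0, 1], by simp [det_fin_three]⟩
  refine ⟨T, orderOf_eq_prime ?_ ?_⟩
  · refine mk_pow_eq_one_iff.mpr (mem_center_of_pow_eq_scalar (c := 1) ?_)
    ext i j
    fin_cases i <;> fin_cases j <;> simp [T, pow_two, mul_apply, Fin.sum_univ_three, two]
  · rw [Ne, QuotientGroup.eq_one_iff]
    exact notMem_center_of_apply_ne_zero (i := 0) (j := 1) (by decide) (by simp [T])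

theorem exists_pow_eq_one (hF : ∀ x : F, x ≠ 0 → x ^ 3 = 1) (x : PSL(3, F)) :
    ∃ n ∈ ({3, 4, 5, 7} : Set ℕ), x ^ n = 1 := by
  obtain ⟨A, rfl⟩ := QuotientGroup.mk_surjective x
  obtain ⟨t, s, hts⟩ := exists_charpoly_eq_cubic A
  have hA : aeval A.1 (cubic t s) = 0 := hts ▸ aeval_self_charpoly A.1
  obtain rfl | ht := eq_or_ne t 0 <;> obtain rfl | hs := eq_or_ne s 0
  · exact ⟨3, by simp, mk_pow_eq_one_of_cubic_dvd hA cubic_dvd_pow_three⟩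
  · exact ⟨7, by simp, mk_pow_eq_one_of_cubic_dvd hA (cubic_dvd_pow_seven_of_zero_left (hF s hs))⟩
  · exact ⟨7, by simp, mk_pow_eq_one_of_cubic_dvd hA (cubic_dvd_pow_seven_of_zero_right (hF t ht))⟩
  obtain rfl | hst := eq_or_ne s (t ^ 2)
  · exact ⟨4, by simp, mk_pow_eq_one_of_cubic_dvd hA (cubic_dvd_pow_four (hF t ht))⟩
  · refine ⟨5, by simp, mk_pow_eq_one_of_cubic_dvd hA (cubic_dvd_pow_five (hF t ht) ?_)⟩
    have ht3 := hF t ht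
    have hs3 := hF s hs
    refine (mul_eq_zero.mp ?_).resolve_left (sub_ne_zero.mpr hst)
    linear_combination hs3 - (1 + t * s) * ht3

theorem orderOf_mem (hF : ∀ x : F, x ≠ 0 → x ^ 3 = 1) (x : PSL(3, F)) :
    orderOf x ∈ ({1, 2, 3, 4, 5, 7} : Set ℕ) := by
  obtain ⟨n, hn, hx⟩ := exists_pow_eq_one hF x
  have hdvd := orderOf_dvd_of_pow_eq_one hx
  have hle : orderOf x ≤ 7 := by
    rcases hn with rfl | rfl | rfl | rfl <;>
      exact (Nat.le_of_dvd (by norm_num) hdvd).trans (by norm_num)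
  generalize orderOf x = m at hdvd hle
  rcases hn with rfl | rfl | rfl | rfl <;> interval_cases m <;> simp_all

end SpecialLinear

theorem card_galoisField : Nat.card (GaloisField 2 2) = 4 :=
  GaloisField.card 2 2 two_ne_zero

theorem pow_three_eq_one {x : GaloisField 2 2} (hx : x ≠ 0) : x ^ 3 = 1 := by
  have := Fintype.ofFinite (GaloisField 2 2)
  have h := FiniteField.pow_card_sub_one_eq_one x hx
  rwa [← Nat.card_eq_fintype_card, card_galoisField] at h

theorem exists_sq_add_self_add_one_eq_zero : ∃ w : GaloisField 2 2, w ^ 2 + w + 1 = 0 := by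
  classical
  have := Fintype.ofFinite (GaloisField 2 2)
  obtain ⟨w, hw⟩ : ∃ w, w ∉ ({0, 1} : Finset (GaloisField 2 2)) := by
    refine (Finset.exists_mem_notMem_of_card_lt_card (t := Finset.univ) ?_).imp fun _ h ↦ h.2
    rw [Finset.card_univ, ← Nat.card_eq_fintype_card, card_galoisField]
    exact Finset.card_le_two.trans_lt (by norm_num)
  simp only [Finset.mem_insert, Finset.mem_singleton, not_or] at hw
  refine ⟨w, (mul_eq_zero.mp ?_).resolve_left (sub_ne_zero.mpr hw.2)⟩
  linear_combination pow_three_eq_one hw.1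

end PSLThreeFour

open PSLThreeFour in
/-- The spectrum (set of element orders) of `PSL(3,4)` is `{1, 2, 3, 4, 5, 7}`. -/
theorem stmt_15 :
    Set.range (orderOf : PSL(3, GaloisField 2 2) → ℕ) = {1, 2, 3, 4, 5, 7} := by
  refine subset_antisymm (Set.range_subset_iff.mpr (orderOf_mem fun _ ↦ pow_three_eq_one)) ?_
  have : Fact (Nat.Prime 5) := ⟨by norm_num⟩
  have : Fact (Nat.Prime 7) := ⟨by norm_num⟩
  obtain ⟨w, hw⟩ := exists_sq_add_self_add_one_eq_zero
  rintro n (rfl | rfl | rfl | rfl | rfl | rfl)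
  · exact ⟨1, orderOf_one⟩
  · exact exists_orderOf_eq_two
  · exact ⟨_, orderOf_mk_companion_of_prime cubic_dvd_pow_three⟩
  · exact ⟨_, orderOf_mk_companion_one_one⟩
  · exact ⟨_, orderOf_mk_companion_of_prime
      (cubic_dvd_pow_five (one_pow 3) (by linear_combination hw : w ^ 2 + 1 ^ 2 * w + 1 = 0))⟩
  · exact ⟨_, orderOf_mk_companion_of_prime (cubic_dvd_pow_seven_of_zero_left (one_pow 3))⟩
end
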